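/- arXiv:1407.8282 — 2 statements merged into one kernel-verified Lean document; each statement's English description precedes it below -/
import Mathlib

section
/- Let d ≥ 1 and s > d. Then the limit lim_{N→∞} ℰ_s(S^d; N)/N^{1+s/d} exists, is finite and strictly positive (Poppy-seed Bagel Theorem specialised to the sphere: the limit equals C_{s,d}/[H_d(S^d)]^{s/d}, where C_{s,d} ∈ (0, ∞) depends only on s and d and H_d(S^d) is the d-dimensional Hausdorff measure of S^d normalised so that the d-dimensional unit cube has measure 1). -/
open MeasureTheory Filter

/-- The minimal `N`-point Riesz `s`-energy `ℰ_s(S^d; N)` of the unit sphere `S^d`. -/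
noncomputable def minRieszEnergy (d : ℕ) (s : ℝ) (N : ℕ) : ℝ :=
  sInf {E : ℝ | ∃ x : Fin N → EuclideanSpace ℝ (Fin (d + 1)),
    Function.Injective x ∧ (∀ i, ‖x i‖ = 1) ∧
    E = ∑ i : Fin N, ∑ j : Fin N, if i = j then 0 else (‖x i - x j‖ ^ s)⁻¹}

namespace PSB

section Energy

variable {E : Type*} [MetricSpace E]

open Classical in
/-- Riesz kernel, vanishing on the diagonal. -/
noncomputable def ker (s : ℝ) (x y : E) : ℝ := if x = y then 0 else (dist x y ^ s)⁻¹

/-- Riesz energy of a finite set. -/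
noncomputable def en (s : ℝ) (X : Finset E) : ℝ := ∑ x ∈ X, ∑ y ∈ X, ker s x y

/-- minimal energy of `n` points of `A`. -/
noncomputable def minEn (A : Set E) (s : ℝ) (n : ℕ) : ℝ :=
  sInf {e : ℝ | ∃ X : Finset E, (X : Set E) ⊆ A ∧ X.card = n ∧ en s X = e}

lemma ker_nonneg (s : ℝ) (x y : E) : 0 ≤ ker s x y := by
  unfold ker; split_ifs <;> positivity

lemma en_nonneg (s : ℝ) (X : Finset E) : 0 ≤ en s X :=
  Finset.sum_nonneg fun _ _ => Finset.sum_nonneg fun _ _ => ker_nonneg _ _ _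

lemma en_mono (s : ℝ) {X Y : Finset E} (h : X ⊆ Y) : en s X ≤ en s Y := by
  unfold en
  calc _ ≤ ∑ x ∈ X, ∑ y ∈ Y, ker s x y := Finset.sum_le_sum fun x _ =>
        Finset.sum_le_sum_of_subset_of_nonneg h fun _ _ _ => ker_nonneg _ _ _
    _ ≤ _ := Finset.sum_le_sum_of_subset_of_nonneg h
        fun _ _ _ => Finset.sum_nonneg fun _ _ => ker_nonneg _ _ _

lemma minEn_le {A : Set E} {s : ℝ} {n : ℕ} {X : Finset E} (hX : (X : Set E) ⊆ A)
    (hn : n ≤ X.card) : minEn A s n ≤ en s X := by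
  obtain ⟨Y, hY, hc⟩ := Finset.exists_subset_card_eq hn
  refine le_trans (csInf_le ⟨0, ?_⟩ ⟨Y, ?_, hc, rfl⟩) (en_mono s hY)
  · rintro _ ⟨X, -, -, rfl⟩; exact en_nonneg _ _
  · exact (Finset.coe_subset.2 hY).trans hX

lemma minEn_set_nonempty {A : Set E} (hA : A.Infinite) (s : ℝ) (n : ℕ) :
    {e : ℝ | ∃ X : Finset E, (X : Set E) ⊆ A ∧ X.card = n ∧ en s X = e}.Nonempty := by
  obtain ⟨X, h1, h2⟩ := hA.exists_subset_card_eq n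
  exact ⟨_, X, h1, h2, rfl⟩

lemma le_minEn {A : Set E} (hA : A.Infinite) {s : ℝ} {n : ℕ} {c : ℝ}
    (h : ∀ X : Finset E, (X : Set E) ⊆ A → X.card = n → c ≤ en s X) : c ≤ minEn A s n := by
  refine le_csInf (minEn_set_nonempty hA s n) ?_
  rintro _ ⟨X, h1, h2, rfl⟩
  exact h X h1 h2

lemma minEn_nonneg (A : Set E) (s : ℝ) (n : ℕ) : 0 ≤ minEn A s n := by
  apply Real.sInf_nonneg
  rintro _ ⟨X, -, -, rfl⟩; exact en_nonneg _ _

lemma exists_lt {A : Set E} (hA : A.Infinite) (s : ℝ) (n : ℕ) {η : ℝ} (hη : 0 < η) :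
    ∃ X : Finset E, (X : Set E) ⊆ A ∧ X.card = n ∧ en s X < minEn A s n + η := by
  obtain ⟨_, ⟨X, h1, h2, rfl⟩, h⟩ := exists_lt_of_csInf_lt (minEn_set_nonempty hA s n)
    (show minEn A s n < minEn A s n + η by linarith)
  exact ⟨X, h1, h2, h⟩

lemma minEn_mono {A : Set E} (hA : A.Infinite) (s : ℝ) {m n : ℕ} (h : m ≤ n) :
    minEn A s m ≤ minEn A s n :=
  le_minEn hA fun _ h1 h2 => minEn_le h1 (h2 ▸ h)

lemma ker_le {s : ℝ} (hs : 0 ≤ s) {x y : E} {D : ℝ} (hD : 0 < D) (h : D ≤ dist x y) :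
    ker s x y ≤ (D ^ s)⁻¹ := by
  unfold ker
  split_ifs
  · positivity
  · gcongr

lemma en_biUnion_le [DecidableEq E] {ι : Type*} [DecidableEq ι] {s : ℝ} (hs : 0 ≤ s) (I : Finset ι) (X : ι → Finset E)
    (D : ι → ι → ℝ) (hD : ∀ i ∈ I, ∀ j ∈ I, i ≠ j → 0 < D i j)
    (h : ∀ i ∈ I, ∀ j ∈ I, i ≠ j → ∀ x ∈ X i, ∀ y ∈ X j, D i j ≤ dist x y) :
    (I.biUnion X).card = ∑ i ∈ I, (X i).card ∧
    en s (I.biUnion X) ≤ ∑ i ∈ I, en s (X i) +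
      ∑ i ∈ I, ∑ j ∈ I, if i = j then 0 else ((X i).card : ℝ) * (X j).card * (D i j ^ s)⁻¹ := by
  have hdis : ∀ i ∈ I, ∀ j ∈ I, i ≠ j → Disjoint (X i) (X j) := by
    intro i hi j hj hij
    rw [Finset.disjoint_left]
    intro x hx hx'
    have := h i hi j hj hij x hx x hx'
    have := hD i hi j hj hij
    simp at *
    linarith
  have hdis' : (I : Set ι).PairwiseDisjoint X := fun i hi j hj hij => hdis i hi j hj hij
  refine ⟨Finset.card_biUnion hdis, ?_⟩
  unfold en
  rw [Finset.sum_biUnion hdis', ← Finset.sum_add_distrib]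
  refine Finset.sum_le_sum fun i hi => ?_
  have : ∀ x, ∑ y ∈ I.biUnion X, ker s x y = ∑ j ∈ I, ∑ y ∈ X j, ker s x y :=
    fun x => Finset.sum_biUnion hdis'
  simp_rw [this]
  rw [Finset.sum_comm]
  rw [← Finset.add_sum_erase I _ hi, ← Finset.add_sum_erase I (fun j => if i = j then _ else _) hi]
  simp only [if_true, zero_add]
  gcongr with j hj
  rw [Finset.mem_erase] at hj
  rw [if_neg (Ne.symm hj.1)]
  calc _ ≤ ∑ x ∈ X i, ∑ y ∈ X j, (D i j ^ s)⁻¹ :=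
        Finset.sum_le_sum fun x hx => Finset.sum_le_sum fun y hy =>
          ker_le hs (hD i hi j hj.2 (Ne.symm hj.1)) (h i hi j hj.2 (Ne.symm hj.1) x hx y hy)
    _ = _ := by simp [mul_assoc]

lemma en_image_le {F : Type*} [MetricSpace F] [DecidableEq F] {s : ℝ} (hs : 0 ≤ s) (ψ : E → F) {c : ℝ} (hc : 0 < c)
    (Y : Finset E) (h : ∀ x ∈ Y, ∀ y ∈ Y, c * dist x y ≤ dist (ψ x) (ψ y)) :
    (Y.image ψ).card = Y.card ∧ en s (Y.image ψ) ≤ (c ^ s)⁻¹ * en s Y := by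
  have hinj : Set.InjOn ψ Y := by
    intro x hx y hy hxy
    have := h x hx y hy
    rw [hxy, dist_self] at this
    have : dist x y ≤ 0 := by
      by_contra h'
      push Not at h'
      have := mul_pos hc h'
      linarith
    exact dist_le_zero.1 this
  refine ⟨Finset.card_image_of_injOn hinj, ?_⟩
  unfold en
  rw [Finset.sum_image hinj, Finset.mul_sum]
  refine Finset.sum_le_sum fun x hx => ?_
  rw [Finset.sum_image hinj, Finset.mul_sum]
  refine Finset.sum_le_sum fun y hy => ?_
  by_cases hxy : x = y
  · simp [ker, hxy]
  · have hne : ψ x ≠ ψ y := fun h' => hxy (hinj hx hy h')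
    have hpos : 0 < dist x y := dist_pos.2 hxy
    simp only [ker, hxy, hne, if_false]
    rw [← mul_inv, ← Real.mul_rpow hc.le hpos.le]
    have := h x hx y hy
    gcongr

/-- pulling back along a Lipschitz map -/
lemma minEn_le_of_subset_image [Nonempty E] {F : Type*} [MetricSpace F] {s : ℝ} (hs : 0 ≤ s)
    (ψ : E → F) {b : ℝ}
    (hb : 0 < b) (Q : Set E) (h : ∀ x ∈ Q, ∀ y ∈ Q, dist (ψ x) (ψ y) ≤ b * dist x y)
    (X : Finset F) (hX : (X : Set F) ⊆ ψ '' Q) : minEn Q s X.card ≤ b ^ s * en s X := by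
  classical
  have : ∀ x : F, ∃ q : E, x ∈ X → q ∈ Q ∧ ψ q = x := by
    intro x
    by_cases hx : x ∈ X
    · obtain ⟨q, hq⟩ := hX hx
      exact ⟨q, fun _ => hq⟩
    · exact ⟨Classical.arbitrary E, fun h => absurd h hx⟩
  choose g hg using this
  obtain ⟨h1, h2⟩ := en_image_le hs g (inv_pos.2 hb) X (by
    intro x hx y hy
    have := h _ (hg x hx).1 _ (hg y hy).1
    rw [(hg x hx).2, (hg y hy).2] at this
    rwa [inv_mul_le_iff₀ hb])
  rw [Real.inv_rpow hb.le, inv_inv] at h2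
  refine le_trans (minEn_le ?_ h1.ge) h2
  intro q hq
  simp only [Finset.coe_image, Set.mem_image, Finset.mem_coe] at hq
  obtain ⟨x, hx, rfl⟩ := hq
  exact (hg x hx).1

/-- superadditivity -/
lemma sum_en_le {ι : Type*} [DecidableEq ι] (s : ℝ) (I : Finset ι) (X : Finset E) (c : E → ι)
    (hc : ∀ x ∈ X, c x ∈ I) : ∑ i ∈ I, en s (X.filter fun x => c x = i) ≤ en s X := by
  conv_rhs => unfold en
  rw [← Finset.sum_fiberwise_of_maps_to hc]
  refine Finset.sum_le_sum fun i _ => Finset.sum_le_sum fun x _ => ?_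
  exact Finset.sum_le_sum_of_subset_of_nonneg (Finset.filter_subset _ _)
    fun _ _ _ => ker_nonneg _ _ _

end Energy

end PSB

namespace PSB

/-- The unit cube. -/
def Q (d : ℕ) : Set (EuclideanSpace ℝ (Fin d)) := {x | ∀ i, 0 ≤ x i ∧ x i ≤ 1}

lemma abs_sub_le_dist {d : ℕ} (x y : EuclideanSpace ℝ (Fin d)) (i : Fin d) :
    |x i - y i| ≤ dist x y := by
  have := PiLp.norm_apply_le (x - y) i
  rw [dist_eq_norm]
  simpa using this

lemma dist_le_of_forall {d : ℕ} (x y : EuclideanSpace ℝ (Fin d)) {t : ℝ} (ht : 0 ≤ t)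
    (h : ∀ i, |x i - y i| ≤ t) : dist x y ≤ √d * t := by
  rw [EuclideanSpace.dist_eq]
  calc _ ≤ √(∑ _i : Fin d, t ^ 2) := by
        gcongr with i
        rw [Real.dist_eq]; exact h i
    _ = √d * t := by
        simp [Real.sqrt_sq ht]

lemma Q_infinite {d : ℕ} (hd : 1 ≤ d) : (Q d).Infinite := by
  have h : (Set.Icc (0 : ℝ) 1).Infinite := Set.Icc_infinite (by norm_num)
  refine (h.image (f := fun t => (WithLp.toLp 2 fun _ => t : EuclideanSpace ℝ (Fin d))) ?_).mono ?_
  · intro a _ b _ hab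
    have := congrArg (fun v : EuclideanSpace ℝ (Fin d) => v ⟨0, hd⟩) hab
    simpa using this
  · rintro _ ⟨t, ht, rfl⟩ i
    exact ht

lemma lattice_sum (d : ℕ) {s : ℝ} (hs : (d : ℝ) < s) : ∃ K : ℝ, 0 ≤ K ∧
    ∀ T : Finset (Fin d → ℤ), ∑ k ∈ T, (if k = 0 then 0 else (‖k‖ ^ s)⁻¹) ≤ K := by
  let b := Pi.basisFun ℝ (Fin d)
  let L := Submodule.span ℤ (Set.range b)
  have hr : Module.finrank ℤ L = d := by
    rw [ZLattice.rank ℝ L]; simp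
  have hsum := ZLattice.summable_norm_rpow L (-s) (by rw [hr]; linarith)
  have hmem : ∀ k : Fin d → ℤ, (fun i => (k i : ℝ)) ∈ L := by
    intro k
    have : (fun i => (k i : ℝ)) = ∑ i, k i • b i := by
      ext j
      simp [b, Finset.sum_apply, Pi.single_apply]
    rw [this]
    exact Submodule.sum_mem _ fun i _ => Submodule.smul_mem _ _ (Submodule.subset_span ⟨i, rfl⟩)
  let e : (Fin d → ℤ) → L := fun k => ⟨fun i => (k i : ℝ), hmem k⟩
  have he : Function.Injective e := by
    intro k k' h
    ext i
    have := congrArg (fun v : L => (v : Fin d → ℝ) i) h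
    simpa [e] using this
  have hs2 := hsum.comp_injective he
  have hnorm : ∀ k, ‖e k‖ = ‖k‖ := by
    intro k
    show ‖(fun i => (k i : ℝ))‖ = _
    simp only [Pi.norm_def]
    congr 2
  refine ⟨∑' k, ‖e k‖ ^ (-s), tsum_nonneg fun _ => by positivity, fun T => ?_⟩
  refine le_trans (Finset.sum_le_sum fun k _ => ?_) (hs2.sum_le_tsum T fun _ _ => by
    dsimp; positivity)
  show _ ≤ ‖e k‖ ^ (-s)
  rw [hnorm]
  split_ifs
  · positivity
  · rw [Real.rpow_neg (norm_nonneg _)]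

lemma flat_step {d : ℕ} (hd : 1 ≤ d) {s : ℝ} (hs : (d : ℝ) < s) : ∃ K : ℝ, 0 ≤ K ∧
    ∀ γ : ℝ, 0 < γ → γ < 1 → ∀ m : ℕ, 1 ≤ m → ∀ n : ℕ,
      minEn (Q d) s (m ^ d * n) ≤ (m : ℝ) ^ d * (((γ / m) ^ s)⁻¹ * (minEn (Q d) s n + 1)) +
        (m : ℝ) ^ d * ((n : ℝ) ^ 2 * (((1 - γ) / m) ^ s)⁻¹ * K) := by
  classical
  obtain ⟨K, hK0, hK⟩ := lattice_sum d hs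
  have hs0 : 0 ≤ s := le_trans (by positivity) hs.le
  refine ⟨K, hK0, fun γ hγ0 hγ1 m hm n => ?_⟩
  have hm0 : (0 : ℝ) < m := by exact_mod_cast hm
  obtain ⟨Y, hYQ, hYn, hYe⟩ := exists_lt (Q_infinite hd) s n one_pos
  let T : (Fin d → Fin m) → EuclideanSpace ℝ (Fin d) → EuclideanSpace ℝ (Fin d) := fun k y =>
    WithLp.toLp 2 fun i => ((k i : ℕ) + γ * y i) / (m : ℝ)
  have hT : ∀ k x y, dist (T k x) (T k y) = γ / m * dist x y := by
    intro k x y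
    have : T k x - T k y = (γ / m) • (x - y) := by
      ext i
      simp [T]
      field_simp
      ring
    rw [dist_eq_norm, this, norm_smul, dist_eq_norm, Real.norm_of_nonneg (by positivity)]
  have him := fun k => en_image_le hs0 (T k) (div_pos hγ0 hm0) Y fun x _ y _ => (hT k x y).ge
  let z : (Fin d → Fin m) → Fin d → ℤ := fun k i => ((k i : ℕ) : ℤ)
  have hz : Function.Injective z := by
    intro k k' h
    ext i
    have := congrFun h i
    simpa [z] using this
  let D : (Fin d → Fin m) → (Fin d → Fin m) → ℝ := fun k k' => (1 - γ) / m * ‖z k' - z k‖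
  have hγ' : 0 < (1 - γ) / m := div_pos (by linarith) hm0
  have hD : ∀ k k', k ≠ k' → 0 < D k k' := by
    intro k k' h
    apply mul_pos hγ'
    rw [norm_pos_iff, sub_ne_zero]
    exact fun h' => h (hz h').symm
  have hsep : ∀ k k', ∀ x ∈ Y, ∀ y ∈ Y, D k k' ≤ dist (T k x) (T k' y) := by
    intro k k' x hx y hy
    have hxQ := hYQ hx
    have hyQ := hYQ hy
    show (1 - γ) / m * ‖z k' - z k‖ ≤ _
    rw [← le_div_iff₀' hγ', pi_norm_le_iff_of_nonneg (by positivity)]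
    intro i
    rw [le_div_iff₀' hγ']
    refine le_trans ?_ (abs_sub_le_dist _ _ i)
    have hi : T k x i - T k' y i = (((k i : ℕ) : ℝ) - (k' i : ℕ) + γ * (x i - y i)) / m := by
      simp [T]; ring
    rw [hi, abs_div, abs_of_pos hm0, div_mul_eq_mul_div]
    gcongr
    have hn : ‖(z k' - z k) i‖ = |(((k i : ℕ) : ℝ) - (k' i : ℕ))| := by
      rw [Int.norm_eq_abs, abs_sub_comm]; simp [z]
    rw [hn]
    have h1 : |x i - y i| ≤ 1 := by
      rw [abs_le]
      constructor <;> linarith [(hxQ i).1, (hxQ i).2, (hyQ i).1, (hyQ i).2]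
    have h2 : |γ * (x i - y i)| ≤ γ := by
      rw [abs_mul, abs_of_pos hγ0]; nlinarith
    by_cases h0 : (k i : ℕ) = (k' i : ℕ)
    · simp only [h0, sub_self, abs_zero, mul_zero]; positivity
    · have h3 : (1 : ℝ) ≤ |(((k i : ℕ) : ℝ) - (k' i : ℕ))| := by
        have : (1 : ℤ) ≤ |((k i : ℕ) : ℤ) - (k' i : ℕ)| := Int.one_le_abs (by omega)
        exact_mod_cast this
      have h4 := abs_sub_abs_le_abs_sub (((k i : ℕ) : ℝ) - (k' i : ℕ)) (-(γ * (x i - y i)))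
      rw [abs_neg, sub_neg_eq_add] at h4
      nlinarith
  obtain ⟨hcard, hen⟩ := en_biUnion_le hs0 Finset.univ (fun k => Y.image (T k)) D
    (fun k _ k' _ h => hD k k' h) (fun k _ k' _ _ x hx y hy => by
      obtain ⟨x', hx', rfl⟩ := Finset.mem_image.1 hx
      obtain ⟨y', hy', rfl⟩ := Finset.mem_image.1 hy
      exact hsep k k' x' hx' y' hy')
  have hcard' : ∀ k, (Y.image (T k)).card = n := fun k => (him k).1.trans hYn
  simp only [hcard'] at hcard hen
  refine le_trans (minEn_le ?_ (le_of_eq ?_)) (hen.trans (add_le_add ?_ ?_))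
  · intro q hq
    simp only [Finset.coe_biUnion, Set.mem_iUnion, Finset.mem_coe, Finset.mem_image] at hq
    obtain ⟨k, -, y, hy, rfl⟩ := hq
    intro i
    have hyQ := hYQ hy i
    have : (((k i : ℕ) : ℝ)) + 1 ≤ m := by exact_mod_cast (k i).2
    simp only [T]
    constructor
    · have := hyQ.1; positivity
    · rw [div_le_one hm0]; nlinarith
  · rw [hcard]; simp
  · calc _ ≤ ∑ k : Fin d → Fin m, ((γ / m) ^ s)⁻¹ * (minEn (Q d) s n + 1) := by
          refine Finset.sum_le_sum fun k _ => (him k).2.trans ?_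
          gcongr
      _ = _ := by
          rw [Finset.sum_const, Finset.card_univ, nsmul_eq_mul]
          simp only [Fintype.card_pi, Fintype.card_fin, Finset.prod_const, Finset.card_univ, Nat.cast_pow]
  · calc _ ≤ ∑ k : Fin d → Fin m, ((n : ℝ) ^ 2 * (((1 - γ) / m) ^ s)⁻¹ * K) := by
          refine Finset.sum_le_sum fun k _ => ?_
          have hinj : Function.Injective fun k' => z k' - z k := fun a b h =>
            hz (sub_left_injective h)
          refine le_trans (le_of_eq ?_) (mul_le_mul_of_nonneg_left
            (hK (Finset.univ.image fun k' => z k' - z k)) (by positivity))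
          rw [Finset.sum_image hinj.injOn, Finset.mul_sum]
          refine Finset.sum_congr rfl fun k' _ => ?_
          by_cases h : k = k'
          · simp [h]
          · rw [if_neg h, if_neg (sub_ne_zero.2 fun h' => h (hz h').symm)]
            simp only [D]
            rw [Real.mul_rpow hγ'.le (norm_nonneg _), mul_inv]
            ring
      _ = _ := by
          rw [Finset.sum_const, Finset.card_univ, nsmul_eq_mul]
          simp only [Fintype.card_pi, Fintype.card_fin, Finset.prod_const, Finset.card_univ, Nat.cast_pow]

lemma flat_lower {d : ℕ} (hd : 1 ≤ d) {s : ℝ} (hs : 0 ≤ s) (m : ℕ) (hm : 1 ≤ m) (n : ℕ) :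
    ((n : ℝ) - (m + 1) ^ d) * ((√d * (1 / m)) ^ s)⁻¹ ≤ minEn (Q d) s n := by
  classical
  have hm0 : (0 : ℝ) < m := by exact_mod_cast hm
  refine le_minEn (Q_infinite hd) fun X hX hn => ?_
  let c : EuclideanSpace ℝ (Fin d) → Fin d → ℤ := fun x i => ⌊m * x i⌋
  let I : Finset (Fin d → ℤ) := Fintype.piFinset fun _ => Finset.Icc (0 : ℤ) m
  have hc : ∀ x ∈ X, c x ∈ I := by
    intro x hx
    simp only [I, Fintype.mem_piFinset, Finset.mem_Icc, c]
    intro i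
    have := hX hx i
    constructor
    · apply Int.floor_nonneg.2
      have := this.1; positivity
    · have h2 : (m : ℝ) * x i ≤ m := by nlinarith [this.2]
      have := Int.floor_le_floor h2
      simpa using this
  have hI : I.card = (m + 1) ^ d := by
    simp only [I, Fintype.card_piFinset, Int.card_Icc]
    simp
  refine le_trans ?_ (sum_en_le s I X c hc)
  have hcell : ∀ i ∈ I, (((X.filter fun x => c x = i).card : ℝ) - 1) * ((√d * (1 / m)) ^ s)⁻¹ ≤
      en s (X.filter fun x => c x = i) := by
    intro i _
    set Z := X.filter fun x => c x = i with hZ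
    have hd' : (0 : ℝ) < √d := Real.sqrt_pos.2 (by exact_mod_cast hd)
    have hker : ∀ x ∈ Z, ∀ y ∈ Z, x ≠ y → ((√d * (1 / m)) ^ s)⁻¹ ≤ ker s x y := by
      intro x hx y hy hxy
      have hpos := dist_pos.2 hxy
      unfold ker
      rw [if_neg hxy]
      gcongr
      apply dist_le_of_forall _ _ (by positivity)
      intro j
      rw [hZ, Finset.mem_filter] at hx hy
      have h1 : ⌊m * x j⌋ = ⌊m * y j⌋ := by
        have := congrFun (hx.2.trans hy.2.symm) j
        exact this
      have h2 := Int.abs_sub_lt_one_of_floor_eq_floor h1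
      rw [← mul_sub, abs_mul, abs_of_pos hm0] at h2
      rw [le_div_iff₀' hm0]
      exact h2.le
    rcases Z.eq_empty_or_nonempty with h0 | h0
    · rw [h0]
      have : 0 ≤ ((√d * (1 / (m : ℝ))) ^ s)⁻¹ := by positivity
      simp [en]
      simpa using this
    · obtain ⟨x, hx⟩ := h0
      calc _ = ∑ y ∈ Z.erase x, ((√d * (1 / (m : ℝ))) ^ s)⁻¹ := by
            rw [Finset.sum_const, Finset.card_erase_of_mem hx, nsmul_eq_mul, Nat.cast_sub]
            · simp
            · exact Finset.card_pos.2 ⟨x, hx⟩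
        _ ≤ ∑ y ∈ Z.erase x, ker s x y := Finset.sum_le_sum fun y hy =>
            hker x hx y (Finset.mem_of_mem_erase hy) (Finset.ne_of_mem_erase hy).symm
        _ ≤ ∑ y ∈ Z, ker s x y := Finset.sum_le_sum_of_subset_of_nonneg
            (Finset.erase_subset _ _) fun _ _ _ => ker_nonneg _ _ _
        _ ≤ en s Z := Finset.single_le_sum (f := fun x => ∑ y ∈ Z, ker s x y)
            (fun _ _ => Finset.sum_nonneg fun _ _ => ker_nonneg _ _ _) hx
  refine le_trans (le_of_eq ?_) (Finset.sum_le_sum hcell)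
  rw [← Finset.sum_mul, Finset.sum_sub_distrib, ← Nat.cast_sum,
    ← Finset.card_eq_sum_card_fiberwise hc, hn]
  simp [hI]

end PSB

namespace PSB

lemma lim_exists (g : ℕ → ℝ) (hg0 : ∀ n, 0 ≤ g n)
    (h : ∀ ε : ℝ, 0 < ε → ∃ N0, ∀ n ≥ N0, ∀ᶠ M in atTop, g M ≤ (1 + ε) * g n + ε) :
    ∃ L, Tendsto g atTop (nhds L) := by
  obtain ⟨N0, h1⟩ := h 1 one_pos
  have hbU : IsBoundedUnder (· ≤ ·) atTop g := ⟨_, eventually_map.2 (h1 N0 le_rfl)⟩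
  have hbL : IsBoundedUnder (· ≥ ·) atTop g := ⟨0, eventually_map.2 (Eventually.of_forall hg0)⟩
  refine ⟨liminf g atTop, tendsto_of_le_liminf_of_limsup_le le_rfl ?_ hbU hbL⟩
  have key : ∀ ε : ℝ, 0 < ε → limsup g atTop ≤ (1 + ε) * liminf g atTop + ε := by
    intro ε hε
    obtain ⟨N1, h2⟩ := h ε hε
    have h3 : (limsup g atTop - ε) / (1 + ε) ≤ liminf g atTop := by
      refine le_liminf_of_le hbU.isCoboundedUnder_ge ?_
      filter_upwards [eventually_ge_atTop N1] with n hn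
      rw [div_le_iff₀ (by linarith)]
      have := limsup_le_of_le hbL.isCoboundedUnder_le (h2 n hn)
      linarith
    rw [div_le_iff₀ (by linarith)] at h3
    linarith
  have ht : Tendsto (fun ε : ℝ => (1 + ε) * liminf g atTop + ε) (nhdsWithin 0 (Set.Ioi 0))
      (nhds ((1 + 0) * liminf g atTop + 0)) := by
    apply Tendsto.mono_left _ nhdsWithin_le_nhds
    apply Continuous.tendsto
    fun_prop
  simp only [add_zero, one_mul] at ht
  exact ge_of_tendsto ht (eventually_nhdsWithin_of_forall fun ε hε => key ε hε)

lemma pow_rpow_p {d : ℕ} (hd : 1 ≤ d) (s : ℝ) {m : ℝ} (hm : 0 < m) :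
    (m ^ d) ^ (1 + s / d) = m ^ d * m ^ s := by
  have hd0 : (d : ℝ) ≠ 0 := by positivity
  rw [← Real.rpow_natCast, ← Real.rpow_mul hm.le, ← Real.rpow_add hm]
  congr 1
  field_simp

lemma flat_step' {d : ℕ} (hd : 1 ≤ d) {s : ℝ} (hs : (d : ℝ) < s) : ∃ K : ℝ, 0 ≤ K ∧
    ∀ γ : ℝ, 0 < γ → γ < 1 → ∀ m : ℕ, 1 ≤ m → ∀ n : ℕ, 1 ≤ n →
      minEn (Q d) s (m ^ d * n) ≤ ((m : ℝ) ^ d * n) ^ (1 + s / d) *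
        ((γ ^ s)⁻¹ * (minEn (Q d) s n / (n : ℝ) ^ (1 + s / d)) +
          ((γ ^ s)⁻¹ * (n : ℝ) ^ (-(1 + s / d)) +
            ((1 - γ) ^ s)⁻¹ * K * (n : ℝ) ^ (-(s / d - 1)))) := by
  obtain ⟨K, hK0, hK⟩ := flat_step hd hs
  refine ⟨K, hK0, fun γ hγ0 hγ1 m hm n hn => (hK γ hγ0 hγ1 m hm n).trans (le_of_eq ?_)⟩
  have hm0 : (0 : ℝ) < m := by exact_mod_cast hm
  have hn0 : (0 : ℝ) < n := by exact_mod_cast hn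
  have h1 : 0 < 1 - γ := by linarith
  rw [Real.mul_rpow (by positivity) hn0.le, pow_rpow_p hd s hm0, Real.div_rpow hγ0.le hm0.le,
    Real.div_rpow h1.le hm0.le, Real.rpow_neg hn0.le]
  have h2 : (n : ℝ) ^ (-(s / d - 1)) = (n : ℝ) ^ 2 / (n : ℝ) ^ (1 + s / d) := by
    rw [← Real.rpow_natCast, ← Real.rpow_sub hn0]
    congr 1
    push_cast; ring
  rw [h2]
  have := Real.rpow_pos_of_pos hm0 s
  have := Real.rpow_pos_of_pos hγ0 s
  have := Real.rpow_pos_of_pos h1 s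
  have := Real.rpow_pos_of_pos hn0 (1 + s / d)
  field_simp
  ring

lemma flat_limit {d : ℕ} (hd : 1 ≤ d) {s : ℝ} (hs : (d : ℝ) < s) : ∃ τ : ℝ, 0 < τ ∧
    Tendsto (fun n : ℕ => minEn (Q d) s n / (n : ℝ) ^ (1 + s / d)) atTop (nhds τ) := by
  have hd0 : (0 : ℝ) < d := by exact_mod_cast hd
  have hs0 : 0 < s := hd0.trans hs
  have hp1 : 0 < s / d - 1 := by
    rw [sub_pos, one_lt_div hd0]; exact hs
  obtain ⟨K, hK0, hK⟩ := flat_step' hd hs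
  set p := 1 + s / d with hp
  have hp0 : 0 < p := by positivity
  set g : ℕ → ℝ := fun n : ℕ => minEn (Q d) s n / (n : ℝ) ^ p with hg
  have hg0 : ∀ n, 0 ≤ g n := fun n => div_nonneg (minEn_nonneg _ _ _) (by positivity)
  obtain ⟨τ, hτ⟩ := lim_exists g hg0 (by
    intro ε hε
    -- choose γ
    have hγ : ∀ᶠ γ : ℝ in nhdsWithin 1 (Set.Iio 1), (γ ^ s)⁻¹ < 1 + ε := by
      have : Tendsto (fun γ : ℝ => (γ ^ s)⁻¹) (nhdsWithin 1 (Set.Iio 1)) (nhds ((1 ^ s)⁻¹)) := by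
        apply Tendsto.mono_left _ nhdsWithin_le_nhds
        apply Tendsto.inv₀ _ (by simp)
        exact (Real.continuousAt_rpow_const 1 s (Or.inl one_ne_zero)).tendsto
      rw [Real.one_rpow, inv_one] at this
      exact this.eventually_lt_const (by linarith)
    have hγ2 : ∀ᶠ γ : ℝ in nhdsWithin 1 (Set.Iio 1), 0 < γ :=
      nhdsWithin_le_nhds (lt_mem_nhds one_pos)
    obtain ⟨γ, ⟨hγ1, hγ0⟩, hγlt⟩ := ((hγ.and hγ2).and self_mem_nhdsWithin).exists
    have hγlt : γ < 1 := hγlt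
    have herr : Tendsto (fun n : ℕ => (γ ^ s)⁻¹ * (n : ℝ) ^ (-p) +
            ((1 - γ) ^ s)⁻¹ * K * (n : ℝ) ^ (-(s / d - 1))) atTop (nhds 0) := by
      have h1 := ((tendsto_rpow_neg_atTop hp0).comp tendsto_natCast_atTop_atTop).const_mul
        ((γ ^ s)⁻¹)
      have h2 := ((tendsto_rpow_neg_atTop hp1).comp tendsto_natCast_atTop_atTop).const_mul
        (((1 - γ) ^ s)⁻¹ * K)
      simpa using h1.add h2
    obtain ⟨N0, hN0⟩ := eventually_atTop.1 ((herr.eventually_lt_const (half_pos hε)).and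
      (eventually_ge_atTop 1))
    refine ⟨N0, fun n hn => ?_⟩
    obtain ⟨hn1, hn2⟩ := hN0 n hn
    have hn0 : (0 : ℝ) < n := by exact_mod_cast hn2
    set B := (γ ^ s)⁻¹ * g n + ((γ ^ s)⁻¹ * (n : ℝ) ^ (-p) +
            ((1 - γ) ^ s)⁻¹ * K * (n : ℝ) ^ (-(s / d - 1))) with hB
    have h1γ : 0 < 1 - γ := by linarith
    have hB0 : 0 ≤ B := by have := hg0 n; positivity
    have hBlt : B < (1 + ε) * g n + ε := by
      have := mul_le_mul_of_nonneg_right hγ1.le (hg0 n)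
      linarith
    have hlim : Tendsto (fun M : ℕ => ((1 + (M / n : ℝ) ^ (-(1 / d : ℝ))) ^ d) ^ p * B) atTop
        (nhds B) := by
      have h1 : Tendsto (fun M : ℕ => (M / n : ℝ) ^ (-(1 / d : ℝ))) atTop (nhds 0) :=
        (tendsto_rpow_neg_atTop (by positivity)).comp
          (tendsto_natCast_atTop_atTop.atTop_div_const hn0)
      have h2 := (((h1.const_add 1).pow d).rpow_const (p := p) (Or.inr hp0.le)).mul_const B
      simpa using h2
    filter_upwards [hlim.eventually_lt_const hBlt, eventually_ge_atTop 1] with M hM hM1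
    refine le_trans ?_ hM.le
    have hM0 : (0 : ℝ) < M := by exact_mod_cast hM1
    set r : ℝ := (M / n : ℝ) ^ (1 / d : ℝ) with hr
    have hr0 : 0 < r := by positivity
    have hrd : r ^ d = M / n := by
      rw [hr, one_div, Real.rpow_inv_natCast_pow (by positivity) (by omega)]
    have hrm : (M / n : ℝ) ^ (-(1 / d : ℝ)) = r⁻¹ := by
      rw [Real.rpow_neg (by positivity)]
    set m := ⌈r⌉₊ with hm
    have hm1 : 1 ≤ m := Nat.one_le_ceil_iff.2 hr0
    have hmr : r ≤ m := Nat.le_ceil r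
    have hmr2 : (m : ℝ) ≤ r + 1 := (Nat.ceil_lt_add_one hr0.le).le
    have hMle : M ≤ m ^ d * n := by
      have : (M : ℝ) ≤ (m : ℝ) ^ d * n := by
        rw [← div_le_iff₀ hn0, ← hrd]
        gcongr
      exact_mod_cast this
    have hstep := (minEn_mono (Q_infinite hd) s hMle).trans (hK γ hγ0 hγlt m hm1 n hn2)
    show minEn (Q d) s M / (M : ℝ) ^ p ≤ _
    rw [div_le_iff₀ (by positivity), hrm]
    refine hstep.trans ?_
    rw [mul_right_comm _ B, ← Real.mul_rpow (by positivity) hM0.le]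
    refine mul_le_mul_of_nonneg_right ?_ hB0
    refine Real.rpow_le_rpow (by positivity) ?_ hp0.le
    have hMr : (M : ℝ) = r ^ d * n := by rw [hrd]; field_simp
    rw [hMr, ← mul_assoc, ← mul_pow]
    have : (1 + r⁻¹) * r = r + 1 := by field_simp
    rw [this]
    gcongr)
  refine ⟨τ, ?_, hτ⟩
  -- positivity
  have hsub : Tendsto (fun m : ℕ => 2 * (m + 1) ^ d) atTop atTop := by
    apply tendsto_atTop_mono (f := fun m : ℕ => m) _ tendsto_id
    intro m
    have := Nat.le_self_pow (show d ≠ 0 by omega) (m + 1)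
    show m ≤ _
    omega
  have hτ2 := hτ.comp hsub
  have hc : 0 < ((2 * √d) ^ s)⁻¹ / 2 ^ p := by
    have : 0 < √(d : ℝ) := Real.sqrt_pos.2 hd0
    positivity
  refine lt_of_lt_of_le hc (ge_of_tendsto hτ2 ?_)
  filter_upwards [eventually_ge_atTop 1] with m hm
  have hm0 : (1 : ℝ) ≤ m := by exact_mod_cast hm
  have hsq : 0 < √(d : ℝ) := Real.sqrt_pos.2 hd0
  have hl := flat_lower hd hs0.le m hm (2 * (m + 1) ^ d)
  show _ ≤ minEn (Q d) s (2 * (m + 1) ^ d) / ((2 * (m + 1) ^ d : ℕ) : ℝ) ^ p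
  rw [le_div_iff₀ (by positivity)]
  refine le_trans ?_ hl
  push_cast
  rw [Real.mul_rpow (x := 2) (y := ((m : ℝ) + 1) ^ d) (by norm_num) (by positivity), hp,
    pow_rpow_p hd s (by positivity)]
  have e1 : (2 * (m + 1 : ℝ) ^ d - (m + 1) ^ d) = (m + 1) ^ d := by ring
  rw [e1]
  have e2 : ((2 * √(d : ℝ)) ^ s)⁻¹ * (m + 1 : ℝ) ^ s ≤ ((√(d : ℝ) * (1 / m)) ^ s)⁻¹ := by
    rw [← Real.inv_rpow (by positivity), ← Real.inv_rpow (by positivity),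
      ← Real.mul_rpow (by positivity) (by positivity)]
    refine Real.rpow_le_rpow (by positivity) ?_ hs0.le
    rw [inv_mul_le_iff₀ (by positivity)]
    field_simp
    linarith
  calc _ = (m + 1 : ℝ) ^ d * (((2 * √(d : ℝ)) ^ s)⁻¹ * (m + 1 : ℝ) ^ s) := by
        field_simp
    _ ≤ _ := by gcongr

end PSB

namespace PSB

lemma holder_aux {d : ℕ} (hd : 1 ≤ d) {s : ℝ} (hs : (d : ℝ) < s) {ι : Type*} [Fintype ι]
    (b n : ι → ℝ) (hb : ∀ i, 0 < b i) (hn : ∀ i, 0 ≤ n i) :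
    (∑ i, n i) ^ (1 + s / d) ≤
      (∑ i, (b i ^ s)⁻¹ * n i ^ (1 + s / d)) * (∑ i, b i ^ d) ^ (s / d) := by
  have hd0 : (0 : ℝ) < d := by exact_mod_cast hd
  have hs0 : 0 < s := hd0.trans hs
  set p := 1 + s / d with hp
  have hp1 : 1 ≤ p := by rw [hp]; have : 0 < s / d := by positivity
                         linarith
  have hp0 : 0 < p := by linarith
  have h := Real.inner_le_weight_mul_Lp_of_nonneg Finset.univ hp1 (fun i => b i ^ d)
    (fun i => n i / b i ^ d) (fun i => by have := hb i; positivity)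
    (fun i => by have := hb i; have := hn i; positivity)
  have h1 : ∀ i, b i ^ d * (n i / b i ^ d) = n i := fun i => by
    have := hb i; field_simp
  have h2 : ∀ i, b i ^ d * (n i / b i ^ d) ^ p = (b i ^ s)⁻¹ * n i ^ p := fun i => by
    have hbi := hb i
    rw [Real.div_rpow (hn i) (by positivity), hp, pow_rpow_p hd s hbi]
    have := Real.rpow_pos_of_pos hbi s
    field_simp
  simp only [h1, h2] at h
  have hA : 0 ≤ ∑ i, b i ^ d := Finset.sum_nonneg fun i _ => by have := hb i; positivity
  have hB : 0 ≤ ∑ i, (b i ^ s)⁻¹ * n i ^ p := Finset.sum_nonneg fun i _ => by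
    have := hb i; have := hn i; positivity
  calc (∑ i, n i) ^ p ≤ ((∑ i, b i ^ d) ^ (1 - p⁻¹) *
        (∑ i, (b i ^ s)⁻¹ * n i ^ p) ^ p⁻¹) ^ p :=
        Real.rpow_le_rpow (Finset.sum_nonneg fun i _ => hn i) h hp0.le
    _ = _ := by
        rw [Real.mul_rpow (by positivity) (by positivity), ← Real.rpow_mul hA, ← Real.rpow_mul hB,
          inv_mul_cancel₀ hp0.ne', Real.rpow_one, mul_comm]
        congr 2
        rw [sub_mul, inv_mul_cancel₀ hp0.ne', hp]; ring

lemma lower_bound {d : ℕ} (hd : 1 ≤ d) {s : ℝ} (hs : (d : ℝ) < s) {τ : ℝ}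
    (hτ : Tendsto (fun n : ℕ => minEn (Q d) s n / (n : ℝ) ^ (1 + s / d)) atTop (nhds τ))
    {F : Type*} [MetricSpace F] {S : Set F} (hS : S.Infinite) {ι : Type*} [Fintype ι] [Nonempty ι]
    (ψ : ι → EuclideanSpace ℝ (Fin d) → F) (b : ι → ℝ) (hb : ∀ i, 0 < b i)
    (hψ : ∀ i, ∀ x ∈ Q d, ∀ y ∈ Q d, dist (ψ i x) (ψ i y) ≤ b i * dist x y)
    (hcov : ∀ z ∈ S, ∃ i, z ∈ ψ i '' Q d) {t : ℝ} (ht0 : 0 ≤ t) (ht : t < τ) :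
    ∃ C : ℝ, ∀ N : ℕ, t * (N : ℝ) ^ (1 + s / d) / (∑ i, b i ^ d) ^ (s / d) - C ≤ minEn S s N := by
  classical
  have hd0 : (0 : ℝ) < d := by exact_mod_cast hd
  have hs0 : 0 < s := hd0.trans hs
  have hpp : 0 ≤ 1 + s / d := by positivity
  obtain ⟨N0, hN0⟩ := eventually_atTop.1 (hτ.eventually_const_lt ht)
  have hC : ∀ n : ℕ, t * (n : ℝ) ^ (1 + s / d) - t * (N0 : ℝ) ^ (1 + s / d) ≤ minEn (Q d) s n := by
    intro n
    rcases lt_or_ge n N0 with h | h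
    · refine le_trans ?_ (minEn_nonneg _ _ _)
      rw [sub_nonpos]
      have : (n : ℝ) ≤ N0 := by exact_mod_cast h.le
      gcongr
    · have h1 := hN0 n h
      have h3 : 0 ≤ t * (N0 : ℝ) ^ (1 + s / d) := by positivity
      rcases Nat.eq_zero_or_pos n with h0 | h0
      · subst h0
        have := minEn_nonneg (Q d) s 0
        rw [Nat.cast_zero, Real.zero_rpow (by positivity)]
        linarith
      · have hn0 : (0 : ℝ) < n := by exact_mod_cast h0
        rw [lt_div_iff₀ (by positivity)] at h1
        linarith
  set c0 := t * (N0 : ℝ) ^ (1 + s / d) with hc0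
  have hVp : 0 < ∑ i, b i ^ d :=
    Finset.sum_pos (fun i _ => by have := hb i; positivity) Finset.univ_nonempty
  refine ⟨∑ i, (b i ^ s)⁻¹ * c0, fun N => le_minEn hS fun X hX hN => ?_⟩
  have : ∀ z, ∃ i, z ∈ X → z ∈ ψ i '' Q d := by
    intro z
    by_cases hz : z ∈ X
    · obtain ⟨i, hi⟩ := hcov z (hX hz)
      exact ⟨i, fun _ => hi⟩
    · exact ⟨Classical.arbitrary ι, fun h => absurd h hz⟩
  choose c hc using this
  refine le_trans ?_ (sum_en_le s Finset.univ X c fun _ _ => Finset.mem_univ _)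
  set n : ι → ℕ := fun i => (X.filter fun x => c x = i).card with hn
  have hen : ∀ i, (b i ^ s)⁻¹ * (t * (n i : ℝ) ^ (1 + s / d) - c0) ≤
      en s (X.filter fun x => c x = i) := by
    intro i
    have hbi := Real.rpow_pos_of_pos (hb i) s
    rw [inv_mul_le_iff₀ hbi]
    refine (hC (n i)).trans (minEn_le_of_subset_image hs0.le (ψ i) (hb i) (Q d) (hψ i) _ ?_)
    intro x hx
    simp only [Finset.coe_filter, Set.mem_ofPred_eq] at hx
    have := hc x hx.1
    rwa [hx.2] at this
  refine le_trans ?_ (Finset.sum_le_sum fun i _ => hen i)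
  have hH := holder_aux hd hs b (fun i => (n i : ℝ)) hb fun i => by positivity
  have hsum : ∑ i, (n i : ℝ) = N := by
    rw [← hN, ← Nat.cast_sum]
    congr 1
    exact (Finset.card_eq_sum_card_fiberwise fun _ _ => Finset.mem_univ _).symm
  rw [hsum] at hH
  simp only [mul_sub, Finset.sum_sub_distrib]
  gcongr
  rw [div_le_iff₀ (by positivity)]
  calc _ ≤ t * ((∑ i, (b i ^ s)⁻¹ * (n i : ℝ) ^ (1 + s / d)) * (∑ i, b i ^ d) ^ (s / d)) := by
        gcongr
    _ = _ := by
        rw [← mul_assoc, Finset.mul_sum]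
        congr 1
        refine Finset.sum_congr rfl fun i _ => ?_
        ring

lemma upper_bound {d : ℕ} (hd : 1 ≤ d) {s : ℝ} (hs : (d : ℝ) < s) {τ : ℝ}
    (hτ : Tendsto (fun n : ℕ => minEn (Q d) s n / (n : ℝ) ^ (1 + s / d)) atTop (nhds τ))
    {F : Type*} [MetricSpace F] {S : Set F} {ι : Type*} [Fintype ι] [Nonempty ι]
    (ψ : ι → EuclideanSpace ℝ (Fin d) → F) (c : ι → ℝ) (hc : ∀ i, 0 < c i)
    (hψ : ∀ i, ∀ x ∈ Q d, ∀ y ∈ Q d, c i * dist x y ≤ dist (ψ i x) (ψ i y))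
    (hmem : ∀ i, ∀ x ∈ Q d, ψ i x ∈ S) {δ : ℝ} (hδ : 0 < δ)
    (hsep : ∀ i j, i ≠ j → ∀ x ∈ Q d, ∀ y ∈ Q d, δ ≤ dist (ψ i x) (ψ j y))
    {u : ℝ} (hu : τ / (∑ i, c i ^ d) ^ (s / d) < u) :
    ∀ᶠ N : ℕ in atTop, minEn S s N / (N : ℝ) ^ (1 + s / d) ≤ u := by
  classical
  have hd0 : (0 : ℝ) < d := by exact_mod_cast hd
  have hs0 : 0 < s := hd0.trans hs
  have hp1 : 0 < s / d - 1 := by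
    rw [sub_pos, one_lt_div hd0]; exact hs
  set p := 1 + s / d with hp
  have hp0 : 0 < p := by positivity
  set V := ∑ i, c i ^ d with hV
  have hVp : 0 < V :=
    Finset.sum_pos (fun i _ => by have := hc i; positivity) Finset.univ_nonempty
  -- number of points in the i-th piece
  let n : ι → ℕ → ℕ := fun i N => ⌈(c i ^ d / V) * (N : ℝ)⌉₊
  have hw : ∀ i, 0 < c i ^ d / V := fun i => by have := hc i; positivity
  have hnN : ∀ i, Tendsto (fun N : ℕ => (n i N : ℝ) / N) atTop (nhds (c i ^ d / V)) := fun i =>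
    (tendsto_nat_ceil_mul_div_atTop (hw i).le).comp tendsto_natCast_atTop_atTop
  have hninf : ∀ i, Tendsto (n i) atTop atTop := fun i =>
    tendsto_nat_ceil_atTop.comp (tendsto_natCast_atTop_atTop.const_mul_atTop (hw i))
  have hNp : Tendsto (fun N : ℕ => ((N : ℝ) ^ p)⁻¹) atTop (nhds 0) :=
    ((tendsto_rpow_atTop hp0).comp tendsto_natCast_atTop_atTop).inv_tendsto_atTop
  let U : ℕ → ℝ := fun N => ∑ i, (c i ^ s)⁻¹ * (minEn (Q d) s (n i N) / (n i N : ℝ) ^ p *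
    ((n i N : ℝ) / N) ^ p + ((N : ℝ) ^ p)⁻¹) +
    ∑ i, ∑ j, ((n i N : ℝ) / N) * ((n j N : ℝ) / N) * (δ ^ s)⁻¹ * (N : ℝ) ^ (-(s / d - 1))
  have hU : Tendsto U atTop (nhds (∑ i, (c i ^ s)⁻¹ * (τ * (c i ^ d / V) ^ p + 0) +
      ∑ i, ∑ j, (c i ^ d / V) * (c j ^ d / V) * (δ ^ s)⁻¹ * 0)) := by
    apply Tendsto.add
    · refine tendsto_finsetSum _ fun i _ => Tendsto.const_mul _ (Tendsto.add (Tendsto.mul ?_ ?_) hNp)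
      · exact hτ.comp (hninf i)
      · exact (hnN i).rpow_const (Or.inr hp0.le)
    · refine tendsto_finsetSum _ fun i _ => tendsto_finsetSum _ fun j _ => ?_
      refine (((hnN i).mul (hnN j)).mul_const _).mul ?_
      exact (tendsto_rpow_neg_atTop hp1).comp tendsto_natCast_atTop_atTop
  have hlim : (∑ i, (c i ^ s)⁻¹ * (τ * (c i ^ d / V) ^ p + 0) +
      ∑ i, ∑ j, (c i ^ d / V) * (c j ^ d / V) * (δ ^ s)⁻¹ * 0) = τ / V ^ (s / d) := by
    simp only [mul_zero, Finset.sum_const_zero, add_zero]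
    have : ∀ i, (c i ^ s)⁻¹ * (τ * (c i ^ d / V) ^ p) = τ / V ^ p * c i ^ d := by
      intro i
      have hci := hc i
      rw [Real.div_rpow (by positivity) hVp.le, hp, pow_rpow_p hd s hci]
      have := Real.rpow_pos_of_pos hci s
      field_simp
    simp only [this]
    rw [← Finset.mul_sum, ← hV, hp, Real.rpow_add hVp, Real.rpow_one]
    field_simp
  rw [hlim] at hU
  filter_upwards [hU.eventually_lt_const hu, eventually_ge_atTop 1,
    eventually_all.2 fun i => (hninf i).eventually_ge_atTop 1] with N hN hN1 hn1
  refine le_trans ?_ hN.le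
  have hN0 : (0 : ℝ) < N := by exact_mod_cast hN1
  have hn0 : ∀ i, (0 : ℝ) < n i N := fun i => by exact_mod_cast hn1 i
  rw [div_le_iff₀ (by positivity)]
  have hY := fun i => exists_lt (Q_infinite hd) s (n i N) one_pos
  choose Y hYQ hYn hYe using hY
  have him := fun i => en_image_le hs0.le (ψ i) (hc i) (Y i)
    fun x hx y hy => hψ i x (hYQ i hx) y (hYQ i hy)
  obtain ⟨hcard, hen⟩ := en_biUnion_le hs0.le Finset.univ (fun i => (Y i).image (ψ i)) (fun _ _ => δ)
    (fun _ _ _ _ _ => hδ) (fun i _ j _ hij x hx y hy => by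
      obtain ⟨x', hx', rfl⟩ := Finset.mem_image.1 hx
      obtain ⟨y', hy', rfl⟩ := Finset.mem_image.1 hy
      exact hsep i j hij x' (hYQ i hx') y' (hYQ j hy'))
  have hcard' : ∀ i, ((Y i).image (ψ i)).card = n i N := fun i => (him i).1.trans (hYn i)
  simp only [hcard'] at hcard hen
  refine le_trans (minEn_le ?_ ?_) (hen.trans ?_)
  · intro q hq
    simp only [Finset.coe_biUnion, Set.mem_iUnion, Finset.mem_coe, Finset.mem_image] at hq
    obtain ⟨i, -, y, hy, rfl⟩ := hq
    exact hmem i y (hYQ i hy)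
  · rw [hcard]
    have : (N : ℝ) ≤ ∑ i, (n i N : ℝ) := by
      calc (N : ℝ) = ∑ i, (c i ^ d / V) * (N : ℝ) := by
            rw [← Finset.sum_mul, ← Finset.sum_div, ← hV]; field_simp
        _ ≤ _ := Finset.sum_le_sum fun i _ => Nat.le_ceil _
    exact_mod_cast this
  · simp only [U]
    rw [add_mul, Finset.sum_mul, Finset.sum_mul]
    refine add_le_add (Finset.sum_le_sum fun i _ => ?_) (Finset.sum_le_sum fun i _ => ?_)
    · refine (him i).2.trans ?_
      rw [mul_assoc]
      have hci := hc i
      gcongr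
      refine (hYe i).le.trans (le_of_eq ?_)
      have h1 := Real.rpow_pos_of_pos hN0 p
      have h2 := Real.rpow_pos_of_pos (hn0 i) p
      rw [Real.div_rpow (hn0 i).le hN0.le]
      field_simp
    · rw [Finset.sum_mul]
      refine Finset.sum_le_sum fun j _ => ?_
      have e : (n i N : ℝ) / N * (n j N / N) * (δ ^ s)⁻¹ * (N : ℝ) ^ (-(s / d - 1)) * (N : ℝ) ^ p
          = n i N * n j N * (δ ^ s)⁻¹ := by
        have : (N : ℝ) ^ (-(s / d - 1)) * (N : ℝ) ^ p = N ^ 2 := by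
          rw [← Real.rpow_add hN0, hp, ← Real.rpow_natCast]
          congr 1
          push_cast; ring
        rw [mul_assoc, this]
        field_simp
      rw [e]
      split_ifs
      · positivity
      · exact le_rfl

end PSB

namespace PSB

/-- Inverse stereographic projection (from one of the two poles, according to the sign `σ`). -/
noncomputable def stereo {d : ℕ} (σ : ℝ) (x : EuclideanSpace ℝ (Fin d)) :
    EuclideanSpace ℝ (Fin (d + 1)) :=
  WithLp.toLp 2 (Fin.cons (σ * ((‖x‖ ^ 2 - 1) / (‖x‖ ^ 2 + 1))) fun i => 2 * x i / (‖x‖ ^ 2 + 1))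

/-- square root of `1 + |x|²`. -/
noncomputable def W {d : ℕ} (x : EuclideanSpace ℝ (Fin d)) : ℝ := √(1 + ‖x‖ ^ 2)

lemma W_sq {d : ℕ} (x : EuclideanSpace ℝ (Fin d)) : W x ^ 2 = 1 + ‖x‖ ^ 2 :=
  Real.sq_sqrt (by positivity)

lemma one_le_W {d : ℕ} (x : EuclideanSpace ℝ (Fin d)) : 1 ≤ W x := by
  unfold W; rw [Real.one_le_sqrt]; nlinarith [sq_nonneg ‖x‖]

lemma W_le {d : ℕ} (x z : EuclideanSpace ℝ (Fin d)) {t : ℝ} (h : dist x z ≤ t) :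
    W x ≤ (1 + t) * W z := by
  have ht : 0 ≤ t := dist_nonneg.trans h
  have hz := one_le_W z
  refine le_of_sq_le_sq ?_ (by positivity)
  rw [mul_pow, W_sq, W_sq]
  have h1 : ‖x‖ ≤ ‖z‖ + t := by
    have := norm_le_norm_add_norm_sub z x
    rw [← dist_eq_norm, dist_comm] at this
    linarith
  have h2 : ‖x‖ ^ 2 ≤ (‖z‖ + t) ^ 2 := by gcongr
  have h0 := norm_nonneg z
  nlinarith [sq_nonneg (‖z‖ - 1), mul_nonneg ht (sq_nonneg (‖z‖ - 1)),
    mul_nonneg ht (sq_nonneg ‖z‖), sq_nonneg (t * ‖z‖), mul_nonneg ht h0]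

lemma norm_stereo {d : ℕ} {σ : ℝ} (hσ : σ ^ 2 = 1) (x : EuclideanSpace ℝ (Fin d)) :
    ‖stereo σ x‖ = 1 := by
  have h : ‖stereo σ x‖ ^ 2 = 1 := by
    rw [EuclideanSpace.real_norm_sq_eq, Fin.sum_univ_succ]
    simp only [stereo, Fin.cons_zero, Fin.cons_succ, div_pow, mul_pow, hσ]
    rw [← Finset.sum_div, ← Finset.mul_sum, ← EuclideanSpace.real_norm_sq_eq]
    have : ‖x‖ ^ 2 + 1 ≠ 0 := by positivity
    field_simp
    ring
  nlinarith [norm_nonneg (stereo σ x)]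

lemma dist_stereo {d : ℕ} {σ : ℝ} (hσ : σ ^ 2 = 1) (x y : EuclideanSpace ℝ (Fin d)) :
    dist (stereo σ x) (stereo σ y) = 2 * dist x y / (W x * W y) := by
  have hx := one_le_W x
  have hy := one_le_W y
  refine (sq_eq_sq₀ dist_nonneg (by positivity)).1 ?_
  rw [div_pow, mul_pow, mul_pow, W_sq, W_sq, dist_eq_norm, dist_eq_norm,
    EuclideanSpace.real_norm_sq_eq, Fin.sum_univ_succ, EuclideanSpace.real_norm_sq_eq (x - y)]
  simp only [stereo, PiLp.sub_apply, Fin.cons_zero, Fin.cons_succ]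
  have hX := EuclideanSpace.real_norm_sq_eq x
  have hY := EuclideanSpace.real_norm_sq_eq y
  set A := ‖x‖ ^ 2 with hA
  set B := ‖y‖ ^ 2 with hB
  have hA0 : A + 1 ≠ 0 := by positivity
  have hB0 : B + 1 ≠ 0 := by positivity
  have hA1 : 1 + A ≠ 0 := by positivity
  have hB1 : 1 + B ≠ 0 := by positivity
  have e1 : ∑ i, (x i - y i) ^ 2 = A - 2 * (∑ i, x i * y i) + B := by
    rw [hX, hY, Finset.mul_sum, ← Finset.sum_sub_distrib, ← Finset.sum_add_distrib]
    exact Finset.sum_congr rfl fun i _ => by ring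
  have e2 : ∑ i, (2 * x i / (A + 1) - 2 * y i / (B + 1)) ^ 2 =
      4 / (A + 1) ^ 2 * A - 8 / ((A + 1) * (B + 1)) * (∑ i, x i * y i) + 4 / (B + 1) ^ 2 * B := by
    conv_rhs => rw [hX, hY]
    rw [← hX, ← hY]
    conv_rhs => rw [hX, hY, Finset.mul_sum, Finset.mul_sum, Finset.mul_sum,
      ← Finset.sum_sub_distrib, ← Finset.sum_add_distrib]
    rw [← hX, ← hY]
    exact Finset.sum_congr rfl fun i _ => by field_simp; ring
  rw [e1, e2]
  have e3 : (σ * ((A - 1) / (A + 1)) - σ * ((B - 1) / (B + 1))) ^ 2 =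
      ((A - 1) / (A + 1) - (B - 1) / (B + 1)) ^ 2 := by
    rw [← mul_sub, mul_pow, hσ, one_mul]
  rw [e3]
  field_simp
  ring

lemma stereo_surj {d : ℕ} {σ : ℝ} (hσ : σ ^ 2 = 1) (z : EuclideanSpace ℝ (Fin (d + 1)))
    (hz : ‖z‖ = 1) (h0 : 0 < 1 - σ * z 0) {r : ℝ} (hr : 0 ≤ r)
    (h : 1 + σ * z 0 ≤ r ^ 2 * (1 - σ * z 0)) :
    ∃ x : EuclideanSpace ℝ (Fin d), ‖x‖ ≤ r ∧ stereo σ x = z := by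
  have hz2 : z 0 ^ 2 + ∑ i : Fin d, z i.succ ^ 2 = 1 := by
    have := EuclideanSpace.real_norm_sq_eq z
    rw [Fin.sum_univ_succ, hz] at this
    linarith
  let x : EuclideanSpace ℝ (Fin d) := WithLp.toLp 2 fun i => z i.succ / (1 - σ * z 0)
  have hx : ‖x‖ ^ 2 = (1 + σ * z 0) / (1 - σ * z 0) := by
    rw [EuclideanSpace.real_norm_sq_eq]
    simp only [x, div_pow]
    rw [← Finset.sum_div, eq_sub_of_add_eq' hz2, div_eq_div_iff (by positivity) h0.ne']
    linear_combination (z 0 ^ 2 * (1 - σ * z 0)) * hσ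
  refine ⟨x, ?_, ?_⟩
  · refine le_of_sq_le_sq ?_ hr
    rw [hx, div_le_iff₀ h0]
    exact h
  · ext j
    have e1 : ‖x‖ ^ 2 + 1 = 2 / (1 - σ * z 0) := by
      rw [hx]; field_simp; ring
    have e2 : ‖x‖ ^ 2 - 1 = 2 * σ * z 0 / (1 - σ * z 0) := by
      rw [hx]; field_simp; ring
    refine Fin.cases ?_ (fun i => ?_) j
    · simp only [stereo, Fin.cons_zero, e1, e2]
      field_simp
      linear_combination z 0 * hσ
    · simp only [stereo, Fin.cons_succ, e1]
      simp only [x]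
      field_simp

lemma stereo_cover {d : ℕ} {R : ℝ} (hR : 0 < R) (z : EuclideanSpace ℝ (Fin (d + 1)))
    (hz : ‖z‖ = 1) :
    (∃ x : EuclideanSpace ℝ (Fin d), ‖x‖ ≤ R ∧ stereo 1 x = z) ∨
    (∃ x : EuclideanSpace ℝ (Fin d), ‖x‖ ≤ 1 / R ∧ stereo (-1) x = z) := by
  have hR2 : 0 < R ^ 2 := by positivity
  rcases le_or_gt (1 + z 0) (R ^ 2 * (1 - z 0)) with h | h
  · left
    have h0 : 0 < 1 - z 0 := by
      by_contra h'
      push Not at h'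
      nlinarith
    exact stereo_surj (by norm_num) z hz (by linarith) hR.le (by linarith)
  · right
    have h0 : 0 < 1 + z 0 := by
      by_contra h'
      push Not at h'
      nlinarith
    refine stereo_surj (by norm_num) z hz (by linarith) (by positivity) ?_
    rw [div_pow, one_pow, div_mul_eq_mul_div, le_div_iff₀ hR2]
    linarith

lemma cell_lookup {M : ℕ} (hM : 1 ≤ M) {u : ℝ} (h0 : 0 ≤ u) (h1 : u ≤ M) :
    ∃ k : Fin M, 0 ≤ u - (k : ℕ) ∧ u - (k : ℕ) ≤ 1 := by
  rcases lt_or_eq_of_le h1 with h | h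
  · have hf := Nat.floor_le h0
    have hf2 := Nat.lt_floor_add_one u
    refine ⟨⟨⌊u⌋₊, (Nat.floor_lt h0).2 h⟩, ?_, ?_⟩ <;> simp <;> linarith
  · refine ⟨⟨M - 1, by omega⟩, ?_⟩
    simp only [Nat.cast_sub hM, h]
    constructor <;> push_cast <;> linarith

lemma geometry {d : ℕ} (hd : 1 ≤ d) {ε : ℝ} (hε : 0 < ε) : ∃ M : ℕ, 1 ≤ M ∧
    ∃ (ψ : (Fin d → Fin M) → EuclideanSpace ℝ (Fin d) → EuclideanSpace ℝ (Fin (d + 1)))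
      (c : (Fin d → Fin M) → ℝ) (δ : ℝ)
      (ψ' : Option (Fin d → Fin M) → EuclideanSpace ℝ (Fin d) → EuclideanSpace ℝ (Fin (d + 1)))
      (b : Option (Fin d → Fin M) → ℝ),
      (∀ i, 0 < c i) ∧ 0 < δ ∧ (∀ i, 0 < b i) ∧
      (∀ i, ∀ x ∈ Q d, ∀ y ∈ Q d, c i * dist x y ≤ dist (ψ i x) (ψ i y)) ∧
      (∀ i, ∀ x ∈ Q d, ψ i x ∈ Metric.sphere (0 : EuclideanSpace ℝ (Fin (d + 1))) 1) ∧
      (∀ i j, i ≠ j → ∀ x ∈ Q d, ∀ y ∈ Q d, δ ≤ dist (ψ i x) (ψ j y)) ∧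
      (∀ i, ∀ x ∈ Q d, ∀ y ∈ Q d, dist (ψ' i x) (ψ' i y) ≤ b i * dist x y) ∧
      (∀ z ∈ Metric.sphere (0 : EuclideanSpace ℝ (Fin (d + 1))) 1, ∃ i, z ∈ ψ' i '' Q d) ∧
      ∑ i, b i ^ d ≤ (1 + ε) * ∑ i, c i ^ d + ε := by
  have hd0 : (0 : ℝ) < d := by exact_mod_cast hd
  have hsd : 0 < √(d : ℝ) := Real.sqrt_pos.2 hd0
  -- choice of `R`
  obtain ⟨R, hR4, hRε⟩ : ∃ R : ℝ, 4 ≤ R ∧ (4 / R) ^ d ≤ ε := by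
    refine ⟨max 4 (4 / ε), le_max_left _ _, ?_⟩
    have h4 : (0 : ℝ) < max 4 (4 / ε) := lt_of_lt_of_le (by norm_num) (le_max_left _ _)
    refine (pow_le_of_le_one (by positivity) ?_ (by omega)).trans ?_
    · rw [div_le_one h4]; exact le_max_left _ _
    · rw [div_le_iff₀ h4, ← div_le_iff₀' hε]; exact le_max_right _ _
  have hR0 : 0 < R := by linarith
  -- choice of `M`
  obtain ⟨M, hM1, hMε⟩ : ∃ M : ℕ, 1 ≤ M ∧ (((1 + √d * (2 * R / M)) ^ 5) ^ d : ℝ) ≤ 1 + ε := by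
    have h1 : Tendsto (fun M : ℕ => (2 * R / M : ℝ)) atTop (nhds 0) :=
      tendsto_const_div_atTop_nhds_zero_nat _
    have h2 := (((h1.const_mul (√d)).const_add 1).pow 5).pow d
    simp only [mul_zero, add_zero, one_pow] at h2
    obtain ⟨M, h3, h4⟩ := ((h2.eventually_lt_const (show (1 : ℝ) < 1 + ε by linarith)).and
      (eventually_ge_atTop 1)).exists
    exact ⟨M, h4, h3.le⟩
  have hM0 : (0 : ℝ) < M := by exact_mod_cast hM1
  set a : ℝ := 2 * R / M with ha
  have ha0 : 0 < a := by positivity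
  have haM : a * M = 2 * R := by rw [ha]; field_simp
  set t : ℝ := √d * a with ht
  have ht0 : 0 < t := by positivity
  set γ : ℝ := 1 / (1 + t) with hγ
  have hγ0 : 0 < γ := by positivity
  have hγ1 : γ < 1 := by rw [hγ, div_lt_one (by positivity)]; linarith
  let z : (Fin d → Fin M) → EuclideanSpace ℝ (Fin d) := fun k =>
    WithLp.toLp 2 fun i => -R + a * (k i : ℕ)
  let P : ℝ → (Fin d → Fin M) → EuclideanSpace ℝ (Fin d) → EuclideanSpace ℝ (Fin d) := fun g k x =>
    WithLp.toLp 2 fun i => -R + a * ((k i : ℕ) + g * x i)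
  have hPdist : ∀ g : ℝ, 0 ≤ g → ∀ k x y, dist (P g k x) (P g k y) = a * g * dist x y := by
    intro g hg k x y
    have : P g k x - P g k y = (a * g) • (x - y) := by
      ext i
      simp [P]
      ring
    rw [dist_eq_norm, this, norm_smul, dist_eq_norm, Real.norm_of_nonneg (by positivity)]
  have hPz : ∀ g : ℝ, 0 ≤ g → g ≤ 1 → ∀ k, ∀ x ∈ Q d, dist (P g k x) (z k) ≤ t := by
    intro g hg0 hg1 k x hx
    refine dist_le_of_forall _ _ ha0.le fun i => ?_
    have : P g k x i - z k i = a * (g * x i) := by simp [P, z]; ring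
    have hxi := hx i
    have h0 : 0 ≤ g * x i := mul_nonneg hg0 hxi.1
    have h1 : g * x i ≤ 1 := mul_le_one₀ hg1 hxi.1 hxi.2
    rw [this, abs_of_nonneg (by positivity)]
    nlinarith
  have hWz : ∀ k, 0 < W (z k) := fun k => lt_of_lt_of_le one_pos (one_le_W _)
  have hWP : ∀ x : EuclideanSpace ℝ (Fin d), 0 < W x := fun k => lt_of_lt_of_le one_pos (one_le_W _)
  let c : (Fin d → Fin M) → ℝ := fun k => 2 * (a * γ) / ((1 + t) * W (z k)) ^ 2
  let b0 : (Fin d → Fin M) → ℝ := fun k => 2 * a * (1 + t) ^ 2 / W (z k) ^ 2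
  have hc0 : ∀ k, 0 < c k := fun k => by have := hWz k; positivity
  have hb00 : ∀ k, 0 < b0 k := fun k => by have := hWz k; positivity
  have hbc : ∀ k, b0 k = (1 + t) ^ 5 * c k := by
    intro k
    have := hWz k
    simp only [b0, c, hγ]
    field_simp
  let δ : ℝ := 2 * (a * (1 - γ)) / (1 + d * R ^ 2)
  have h1γ : 0 < 1 - γ := by linarith
  have hδ : 0 < δ := by positivity
  let ψ' : Option (Fin d → Fin M) → EuclideanSpace ℝ (Fin d) → EuclideanSpace ℝ (Fin (d + 1)) :=
    fun o x => o.elim (stereo (-1) (WithLp.toLp 2 fun i => (2 * x i - 1) / R))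
      fun k => stereo 1 (P 1 k x)
  let b : Option (Fin d → Fin M) → ℝ := fun o => o.elim (4 / R) b0
  have h1 : (1 : ℝ) ^ 2 = 1 := by norm_num
  have h1' : (-1 : ℝ) ^ 2 = 1 := by norm_num
  refine ⟨M, hM1, fun k x => stereo 1 (P γ k x), c, δ, ψ', b, hc0, hδ, ?_, ?_, ?_, ?_, ?_, ?_, ?_⟩
  · rintro (_ | k)
    · show 0 < 4 / R
      positivity
    · exact hb00 k
  · intro k x hx y hy
    rw [dist_stereo h1, hPdist γ hγ0.le]
    have w1 := W_le _ _ (hPz γ hγ0.le hγ1.le k x hx)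
    have w2 := W_le _ _ (hPz γ hγ0.le hγ1.le k y hy)
    have := hWP (P γ k x)
    have := hWP (P γ k y)
    have := hWz k
    calc _ = 2 * (a * γ * dist x y) / (((1 + t) * W (z k)) * ((1 + t) * W (z k))) := by
          simp only [c]; field_simp
      _ ≤ _ := by gcongr
  · intro k x _
    rw [mem_sphere_zero_iff_norm]
    exact norm_stereo h1 _
  · intro k k' hk x hx y hy
    rw [dist_stereo h1]
    have hW : ∀ k, ∀ x ∈ Q d, W (P γ k x) ^ 2 ≤ 1 + d * R ^ 2 := by
      intro k x hx
      rw [W_sq, EuclideanSpace.real_norm_sq_eq]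
      gcongr
      calc ∑ i, P γ k x i ^ 2 ≤ ∑ _i : Fin d, R ^ 2 := by
            refine Finset.sum_le_sum fun i _ => ?_
            rw [sq_le_sq, abs_of_pos hR0, abs_le]
            have hki : (((k i : ℕ) : ℝ)) + 1 ≤ M := by exact_mod_cast (k i).2
            have hxi := hx i
            have h0 : 0 ≤ γ * x i := mul_nonneg hγ0.le hxi.1
            have h1 : γ * x i ≤ 1 := mul_le_one₀ hγ1.le hxi.1 hxi.2
            simp only [P]
            constructor
            · have : 0 ≤ a * (((k i : ℕ) : ℝ) + γ * x i) := by positivity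
              linarith
            · have : a * (((k i : ℕ) : ℝ) + γ * x i) ≤ a * M := by gcongr; linarith
              linarith
        _ = _ := by simp
    have hWW : W (P γ k x) * W (P γ k' y) ≤ 1 + d * R ^ 2 := by
      nlinarith [hW k x hx, hW k' y hy, sq_nonneg (W (P γ k x) - W (P γ k' y))]
    have := hWP (P γ k x)
    have := hWP (P γ k' y)
    have hdist : a * (1 - γ) ≤ dist (P γ k x) (P γ k' y) := by
      obtain ⟨i, hi⟩ := Function.ne_iff.1 hk
      refine le_trans ?_ (abs_sub_le_dist _ _ i)
      have e : P γ k x i - P γ k' y i = a * (((k i : ℕ) : ℝ) - (k' i : ℕ) + γ * (x i - y i)) := by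
        simp [P]; ring
      rw [e, abs_mul, abs_of_pos ha0]
      gcongr
      have hxQ := hx i
      have hyQ := hy i
      have h1 : |x i - y i| ≤ 1 := by
        rw [abs_le]
        constructor <;> linarith [hxQ.1, hxQ.2, hyQ.1, hyQ.2]
      have h2 : |γ * (x i - y i)| ≤ γ := by
        rw [abs_mul, abs_of_pos hγ0]; nlinarith
      have h3 : (1 : ℝ) ≤ |(((k i : ℕ) : ℝ) - (k' i : ℕ))| := by
        have hne : (k i : ℕ) ≠ (k' i : ℕ) := fun h => hi (Fin.ext h)
        have : (1 : ℤ) ≤ |((k i : ℕ) : ℤ) - (k' i : ℕ)| := Int.one_le_abs (by omega)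
        exact_mod_cast this
      have h4 := abs_sub_abs_le_abs_sub (((k i : ℕ) : ℝ) - (k' i : ℕ)) (-(γ * (x i - y i)))
      rw [abs_neg, sub_neg_eq_add] at h4
      linarith
    simp only [δ]
    gcongr
  · rintro (_ | k) x hx y hy
    · show dist (stereo (-1) _) (stereo (-1) _) ≤ 4 / R * dist x y
      rw [dist_stereo h1']
      have e : dist (WithLp.toLp 2 fun i => (2 * x i - 1) / R : EuclideanSpace ℝ (Fin d))
          (WithLp.toLp 2 fun i => (2 * y i - 1) / R) = 2 / R * dist x y := by
        rw [dist_eq_norm, dist_eq_norm, ← Real.norm_of_nonneg (show 0 ≤ 2 / R by positivity),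
          ← norm_smul]
        congr 1
        ext i
        simp
        ring
      rw [e]
      have w1 := one_le_W (WithLp.toLp 2 fun i => (2 * x i - 1) / R : EuclideanSpace ℝ (Fin d))
      have w2 := one_le_W (WithLp.toLp 2 fun i => (2 * y i - 1) / R : EuclideanSpace ℝ (Fin d))
      refine (div_le_self (by positivity) (one_le_mul_of_one_le_of_one_le w1 w2)).trans
        (le_of_eq ?_)
      ring
    · show dist (stereo 1 (P 1 k x)) (stereo 1 (P 1 k y)) ≤ b0 k * dist x y
      rw [dist_stereo h1, hPdist 1 zero_le_one]
      have w1 := W_le (z k) _ ((dist_comm _ _).trans_le (hPz 1 zero_le_one le_rfl k x hx))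
      have w2 := W_le (z k) _ ((dist_comm _ _).trans_le (hPz 1 zero_le_one le_rfl k y hy))
      have := hWP (P 1 k x)
      have := hWP (P 1 k y)
      have := hWz k
      calc _ ≤ 2 * (a * 1 * dist x y) / ((W (z k) / (1 + t)) * (W (z k) / (1 + t))) := by
            gcongr
            · rw [div_le_iff₀ (by positivity)]; linarith
            · rw [div_le_iff₀ (by positivity)]; linarith
        _ = _ := by simp only [b0]; field_simp
  · intro y hy
    rw [mem_sphere_zero_iff_norm] at hy
    rcases stereo_cover hR0 y hy with ⟨x, hx, rfl⟩ | ⟨x, hx, rfl⟩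
    · have hxi : ∀ i, |x i| ≤ R := fun i => by
        have := PiLp.norm_apply_le x i
        rw [Real.norm_eq_abs] at this
        exact this.trans hx
      have hk : ∀ i, ∃ k : Fin M, 0 ≤ (x i + R) / a - (k : ℕ) ∧ (x i + R) / a - (k : ℕ) ≤ 1 := by
        intro i
        have := abs_le.1 (hxi i)
        refine cell_lookup hM1 (div_nonneg (by linarith) ha0.le) ?_
        rw [div_le_iff₀ ha0, mul_comm, haM]
        linarith
      choose k hk using hk
      refine ⟨some k, WithLp.toLp 2 fun i => (x i + R) / a - (k i : ℕ), fun i => hk i, ?_⟩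
      show stereo 1 (P 1 k _) = _
      congr 1
      ext i
      simp only [P]
      field_simp
      ring
    · have hxi : ∀ i, |x i| ≤ 1 / R := fun i => by
        have := PiLp.norm_apply_le x i
        rw [Real.norm_eq_abs] at this
        exact this.trans hx
      refine ⟨none, WithLp.toLp 2 fun i => (R * x i + 1) / 2, fun i => ?_, ?_⟩
      · have := hxi i
        rw [le_div_iff₀' hR0] at this
        have h2 : |R * x i| ≤ 1 := by rwa [abs_mul, abs_of_pos hR0]
        rw [abs_le] at h2
        constructor
        · show 0 ≤ (R * x i + 1) / 2
          linarith
        · show (R * x i + 1) / 2 ≤ 1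
          linarith
      · show stereo (-1) _ = _
        congr 1
        ext i
        simp only
        field_simp
        ring
  · rw [Fintype.sum_option]
    have e : ∑ k, b (some k) ^ d = ((1 + t) ^ 5) ^ d * ∑ k, c k ^ d := by
      rw [Finset.mul_sum]
      refine Finset.sum_congr rfl fun k _ => ?_
      show b0 k ^ d = _
      rw [hbc, mul_pow]
    rw [e]
    have hsum : 0 ≤ ∑ k, c k ^ d := Finset.sum_nonneg fun k _ => by have := hc0 k; positivity
    have := mul_le_mul_of_nonneg_right hMε hsum
    have h3 : b none ^ d ≤ ε := hRε
    linarith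

end PSB

namespace PSB

lemma sphere_infinite {d : ℕ} (hd : 1 ≤ d) :
    (Metric.sphere (0 : EuclideanSpace ℝ (Fin (d + 1))) 1).Infinite := by
  obtain ⟨M, hM, ψ, c, δ, ψ', b, hc, hδ, hb, h1, h2, -⟩ := geometry hd one_pos
  let i : Fin d → Fin M := fun _ => ⟨0, hM⟩
  have hinj : Set.InjOn (ψ i) (Q d) := by
    intro x hx y hy hxy
    have := h1 i x hx y hy
    rw [hxy, dist_self] at this
    have h0 : dist x y ≤ 0 := by
      by_contra h
      push Not at h
      exact absurd this (not_le.2 (mul_pos (hc i) h))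
    exact dist_le_zero.1 h0
  exact ((Q_infinite hd).image hinj).mono (by rintro _ ⟨x, hx, rfl⟩; exact h2 i x hx)

lemma minRiesz_eq (d : ℕ) (s : ℝ) (N : ℕ) :
    minRieszEnergy d s N = minEn (Metric.sphere (0 : EuclideanSpace ℝ (Fin (d + 1))) 1) s N := by
  classical
  have key : ∀ x : Fin N → EuclideanSpace ℝ (Fin (d + 1)), Function.Injective x →
      en s (Finset.univ.image x) =
        ∑ i : Fin N, ∑ j : Fin N, if i = j then 0 else (‖x i - x j‖ ^ s)⁻¹ := by
    intro x hx
    unfold en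
    rw [Finset.sum_image hx.injOn]
    refine Finset.sum_congr rfl fun i _ => ?_
    rw [Finset.sum_image hx.injOn]
    refine Finset.sum_congr rfl fun j _ => ?_
    unfold ker
    simp only [hx.eq_iff, dist_eq_norm]
  unfold minRieszEnergy minEn
  congr 1
  ext e
  constructor
  · rintro ⟨x, hx, h1, rfl⟩
    refine ⟨Finset.univ.image x, ?_, ?_, key x hx⟩
    · intro z hz
      obtain ⟨i, -, rfl⟩ := Finset.mem_image.1 (Finset.mem_coe.1 hz)
      simpa using h1 i
    · rw [Finset.card_image_of_injective _ hx]; simp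
  · rintro ⟨X, hX, hN, rfl⟩
    subst hN
    have hinj : Function.Injective (fun i => ((X.equivFin.symm i : X) :
        EuclideanSpace ℝ (Fin (d + 1)))) :=
      Subtype.val_injective.comp X.equivFin.symm.injective
    refine ⟨_, hinj, fun i => ?_, ?_⟩
    · simpa using hX (X.equivFin.symm i).2
    · rw [← key _ hinj]
      congr 1
      ext z
      simp only [Finset.mem_image, Finset.mem_univ, true_and]
      constructor
      · intro hz; exact ⟨X.equivFin ⟨z, hz⟩, by simp⟩
      · rintro ⟨i, rfl⟩; exact (X.equivFin.symm i).2

lemma sphere_limit {d : ℕ} (hd : 1 ≤ d) {s : ℝ} (hs : (d : ℝ) < s) :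
    ∃ L : ℝ, 0 < L ∧ Tendsto (fun N : ℕ =>
      minEn (Metric.sphere (0 : EuclideanSpace ℝ (Fin (d + 1))) 1) s N / (N : ℝ) ^ (1 + s / d))
      atTop (nhds L) := by
  obtain ⟨τ, hτ0, hτ⟩ := flat_limit hd hs
  have hd0 : (0 : ℝ) < d := by exact_mod_cast hd
  have hs0 : 0 < s := hd0.trans hs
  have hq : 0 < s / d := by positivity
  have hSi := sphere_infinite hd
  set S := Metric.sphere (0 : EuclideanSpace ℝ (Fin (d + 1))) 1 with hS
  set f : ℕ → ℝ := fun N => minEn S s N / (N : ℝ) ^ (1 + s / d) with hf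
  have hf0 : ∀ N, 0 ≤ f N := fun N => div_nonneg (minEn_nonneg _ _ _) (by positivity)
  have main : ∀ ε : ℝ, 0 < ε → ∃ V U : ℝ, 0 < V ∧ 0 < U ∧ U ≤ (1 + ε) * V + ε ∧
      (∀ u, τ / V ^ (s / d) < u → ∀ᶠ N in atTop, f N ≤ u) ∧
      (∀ a, a < τ / U ^ (s / d) → ∀ᶠ N in atTop, a ≤ f N) := by
    intro ε hε
    obtain ⟨M, hM, ψ, c, δ, ψ', b, hc, hδ, hb, h1, h2, h3, h4, h5, h6⟩ := geometry hd hε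
    have : Nonempty (Fin d → Fin M) := ⟨fun _ => ⟨0, hM⟩⟩
    have hV : 0 < ∑ i, c i ^ d := Finset.sum_pos (fun i _ => pow_pos (hc i) d) Finset.univ_nonempty
    have hU : 0 < ∑ i, b i ^ d := Finset.sum_pos (fun i _ => pow_pos (hb i) d) Finset.univ_nonempty
    refine ⟨_, _, hV, hU, h6, fun u hu => upper_bound hd hs hτ ψ c hc h1 h2 hδ h3 hu, ?_⟩
    intro a ha
    rcases le_or_gt a 0 with ha0 | ha0
    · exact Eventually.of_forall fun N => ha0.trans (hf0 N)
    set P := (∑ i, b i ^ d) ^ (s / d) with hP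
    have hP0 : 0 < P := Real.rpow_pos_of_pos hU _
    rw [lt_div_iff₀ hP0] at ha
    have haP : 0 < a * P := mul_pos ha0 hP0
    obtain ⟨C, hC⟩ := lower_bound hd hs hτ hSi ψ' b hb h4 h5
      (t := (a * P + τ) / 2) (by linarith) (by linarith)
    have hlim : Tendsto (fun N : ℕ => (a * P + τ) / 2 / P - C / (N : ℝ) ^ (1 + s / d)) atTop
        (nhds ((a * P + τ) / 2 / P - 0)) := by
      refine tendsto_const_nhds.sub (Tendsto.const_div_atTop ?_ C)
      exact (tendsto_rpow_atTop (by positivity)).comp tendsto_natCast_atTop_atTop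
    have hlt : a < (a * P + τ) / 2 / P - 0 := by
      rw [sub_zero, lt_div_iff₀ hP0]; linarith
    filter_upwards [hlim.eventually_const_lt hlt, eventually_gt_atTop 0] with N hN hN0
    refine hN.le.trans ?_
    have hNp : 0 < (N : ℝ) ^ (1 + s / d) := Real.rpow_pos_of_pos (by exact_mod_cast hN0) _
    rw [hf, le_div_iff₀ hNp]
    refine le_trans (le_of_eq ?_) (hC N)
    rw [← hP, sub_mul, div_mul_cancel₀ _ hNp.ne']
    ring
  obtain ⟨V1, U1, hV1, hU1, -, hup, hlo⟩ := main 1 one_pos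
  have hba : IsBoundedUnder (· ≤ ·) atTop f :=
    isBoundedUnder_of_eventually_le (hup (τ / V1 ^ (s / d) + 1) (by linarith))
  have hbb : IsBoundedUnder (· ≥ ·) atTop f :=
    isBoundedUnder_of_eventually_ge (Eventually.of_forall hf0)
  have hL : ∀ U : ℝ, (∀ a, a < τ / U ^ (s / d) → ∀ᶠ N in atTop, a ≤ f N) →
      τ / U ^ (s / d) ≤ liminf f atTop := fun U h =>
    le_of_forall_lt_imp_le_of_dense fun a ha => le_liminf_of_le hba.isCoboundedUnder_ge (h a ha)
  have hUl : ∀ V : ℝ, (∀ u, τ / V ^ (s / d) < u → ∀ᶠ N in atTop, f N ≤ u) →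
      limsup f atTop ≤ τ / V ^ (s / d) := fun V h =>
    le_of_forall_gt_imp_ge_of_dense fun a ha => limsup_le_of_le hbb.isCoboundedUnder_le (h a ha)
  have hLpos : 0 < liminf f atTop :=
    lt_of_lt_of_le (div_pos hτ0 (Real.rpow_pos_of_pos hU1 _)) (hL U1 hlo)
  have hLU : liminf f atTop ≤ limsup f atTop := liminf_le_limsup hba hbb
  have hUpos := hLpos.trans_le hLU
  set L := liminf f atTop
  set U := limsup f atTop
  have hA : ∀ V : ℝ, 0 < V → (V ^ (s / d)) ^ (s / d)⁻¹ = V := fun V hV =>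
    Real.rpow_rpow_inv hV.le hq.ne'
  have hfin : (τ / L) ^ (s / d)⁻¹ ≤ (τ / U) ^ (s / d)⁻¹ := by
    set A := (τ / L) ^ (s / d)⁻¹
    set B := (τ / U) ^ (s / d)⁻¹ with hB
    have hB0 : 0 ≤ B := by positivity
    refine le_of_forall_pos_le_add fun η hη => ?_
    obtain ⟨V', U', hV', hU', hVU, hu, hl⟩ := main (η / (B + 1)) (by positivity)
    have h1 : A ≤ U' := by
      rw [← hA U' hU']
      refine Real.rpow_le_rpow (by positivity) ?_ (by positivity)
      have := hL U' hl
      rw [div_le_iff₀ (Real.rpow_pos_of_pos hU' _)] at this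
      rw [div_le_iff₀ hLpos]; linarith
    have h2 : V' ≤ B := by
      rw [← hA V' hV']
      refine Real.rpow_le_rpow (by positivity) ?_ (by positivity)
      have := hUl V' hu
      rw [le_div_iff₀ (Real.rpow_pos_of_pos hV' _)] at this
      rw [le_div_iff₀ hUpos]; linarith
    have h3 : (1 + η / (B + 1)) * V' ≤ (1 + η / (B + 1)) * B := by gcongr
    have h4 : (1 + η / (B + 1)) * B + η / (B + 1) = B + η := by
      field_simp
      ring
    linarith
  have hUL : U ≤ L := by
    have := (Real.rpow_le_rpow_iff (by positivity) (by positivity) (by positivity)).1 hfin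
    rwa [div_le_div_iff_of_pos_left hτ0 hLpos hUpos] at this
  exact ⟨L, hLpos, tendsto_of_le_liminf_of_limsup_le le_rfl hUL hba hbb⟩

lemma hausdorff_Q (d : ℕ) : μH[(d : ℝ)] (Q d) < ⊤ := by
  have h1 : Q d ⊆ (WithLp.toLp 2 : (Fin d → ℝ) → EuclideanSpace ℝ (Fin d)) '' Set.Icc 0 1 := by
    intro x hx
    exact ⟨x.ofLp, ⟨fun i => (hx i).1, fun i => (hx i).2⟩, rfl⟩
  have hl := PiLp.lipschitzWith_toLp 2 (fun _ : Fin d => ℝ)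
  refine (measure_mono h1).trans_lt (((hl.lipschitzOnWith (s := Set.Icc 0 1)).hausdorffMeasure_image_le
    (Nat.cast_nonneg d)).trans_lt ?_)
  have h2 : (μH[(d : ℝ)] : Measure (Fin d → ℝ)) = volume := by
    have := hausdorffMeasure_pi_real (ι := Fin d)
    rwa [Fintype.card_fin] at this
  rw [h2]
  refine ENNReal.mul_lt_top ?_ isCompact_Icc.measure_lt_top
  exact ENNReal.rpow_lt_top_of_nonneg (Nat.cast_nonneg d) ENNReal.coe_ne_top

lemma hausdorff_sphere_lt_top {d : ℕ} (hd : 1 ≤ d) :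
    μH[(d : ℝ)] (Metric.sphere (0 : EuclideanSpace ℝ (Fin (d + 1))) 1) < ⊤ := by
  obtain ⟨M, hM, ψ, c, δ, ψ', b, hc, hδ, hb, h1, h2, h3, h4, h5, h6⟩ := geometry hd one_pos
  have hsub : Metric.sphere (0 : EuclideanSpace ℝ (Fin (d + 1))) 1 ⊆ ⋃ i, ψ' i '' Q d := by
    intro z hz
    exact Set.mem_iUnion.2 (h5 z hz)
  refine (measure_mono hsub).trans_lt ((measure_iUnion_le _).trans_lt ?_)
  rw [tsum_fintype]
  refine ENNReal.sum_lt_top.2 fun i _ => ?_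
  have hl : LipschitzOnWith ⟨b i, (hb i).le⟩ (ψ' i) (Q d) :=
    LipschitzOnWith.of_dist_le_mul fun x hx y hy => h4 i x hx y hy
  refine (hl.hausdorffMeasure_image_le (Nat.cast_nonneg d)).trans_lt ?_
  refine ENNReal.mul_lt_top ?_ (hausdorff_Q d)
  exact ENNReal.rpow_lt_top_of_nonneg (Nat.cast_nonneg d) ENNReal.coe_ne_top

lemma hausdorff_sphere_pos (d : ℕ) :
    0 < μH[(d : ℝ)] (Metric.sphere (0 : EuclideanSpace ℝ (Fin (d + 1))) 1) := by
  let T : EuclideanSpace ℝ (Fin (d + 1)) → (Fin d → ℝ) := fun z i => z i.succ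
  have hT : LipschitzWith 1 T := by
    refine LipschitzWith.of_dist_le_mul fun x y => ?_
    rw [NNReal.coe_one, one_mul, dist_pi_le_iff dist_nonneg]
    intro i
    rw [Real.dist_eq]
    exact abs_sub_le_dist x y i.succ
  have h2 : (μH[(d : ℝ)] : Measure (Fin d → ℝ)) = volume := by
    have := hausdorffMeasure_pi_real (ι := Fin d)
    rwa [Fintype.card_fin] at this
  have h3 := hT.hausdorffMeasure_image_le (Nat.cast_nonneg d : (0 : ℝ) ≤ d)
    (Metric.sphere (0 : EuclideanSpace ℝ (Fin (d + 1))) 1)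
  simp only [ENNReal.coe_one, ENNReal.one_rpow, one_mul] at h3
  refine lt_of_lt_of_le ?_ h3
  rw [h2]
  have hopen : IsOpen {v : Fin d → ℝ | ∑ i, v i ^ 2 < 1} :=
    isOpen_lt (by fun_prop) continuous_const
  refine lt_of_lt_of_le (hopen.measure_pos volume ⟨0, by simp⟩) (measure_mono ?_)
  intro v hv
  simp only [Set.mem_ofPred_eq] at hv
  refine ⟨WithLp.toLp 2 (Fin.cons (√(1 - ∑ i, v i ^ 2)) v), ?_, ?_⟩
  · rw [mem_sphere_zero_iff_norm, EuclideanSpace.norm_eq, Real.sqrt_eq_one]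
    simp only [Real.norm_eq_abs, sq_abs]
    rw [Fin.sum_univ_succ]
    simp only [Fin.cons_zero, Fin.cons_succ]
    rw [Real.sq_sqrt (by linarith)]
    ring
  · funext i
    simp [T]

end PSB

/-- Poppy-seed Bagel Theorem for the sphere: for `s > d` the limit
`lim_{N→∞} ℰ_s(S^d; N)/N^{1+s/d}` exists, is finite and strictly positive; it has the form
`C_{s,d}/[H_d(S^d)]^{s/d}` with `C_{s,d} ∈ (0,∞)`, `H_d` being the `d`-dimensional Hausdorff
measure (normalised so that the `d`-dimensional unit cube has measure `1`). -/
theorem poppy_seed_bagel_sphere (d : ℕ) (hd : 1 ≤ d) (s : ℝ) (hsd : (d : ℝ) < s) :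
    ∃ C : ℝ, 0 < C ∧
      Tendsto (fun N : ℕ => minRieszEnergy d s N / (N : ℝ) ^ ((1 : ℝ) + s / d)) atTop
        (nhds (C /
          ((μH[(d : ℝ)] (Metric.sphere (0 : EuclideanSpace ℝ (Fin (d + 1))) 1)).toReal
            ^ (s / (d : ℝ))))) := by
  obtain ⟨L, hL, h⟩ := PSB.sphere_limit hd hsd
  have hH : 0 < (μH[(d : ℝ)] (Metric.sphere (0 : EuclideanSpace ℝ (Fin (d + 1))) 1)).toReal :=
    ENNReal.toReal_pos (PSB.hausdorff_sphere_pos d).ne' (PSB.hausdorff_sphere_lt_top hd).ne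
  have hHp := Real.rpow_pos_of_pos hH (s / (d : ℝ))
  refine ⟨L * _, mul_pos hL hHp, ?_⟩
  rw [mul_div_assoc, div_self hHp.ne', mul_one]
  simpa only [PSB.minRiesz_eq] using h
end

section
/- For d ≥ 1, the minimal N-point Riesz d-energy of S^d satisfies lim_{N→∞} ℰ_d(S^d; N)/(N² log N) = H_d(B^d)/H_d(S^d) = (1/d) · Γ((d+1)/2)/(√π · Γ(d/2)), where B^d is the unit ball in R^d. -/
open Filter

open MeasureTheory


theorem radial_lintegral {E : Type*} [NormedAddCommGroup E] [NormedSpace ℝ E] [MeasurableSpace E]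
    [Nontrivial E] (μ : Measure E) [FiniteDimensional ℝ E] [BorelSpace E] [μ.IsAddHaarMeasure]
    (f : ℝ → ENNReal) (hf : Measurable f) :
    ∫⁻ x, f ‖x‖ ∂μ = μ.toSphere Set.univ *
      ∫⁻ y in Set.Ioi (0:ℝ), ENNReal.ofReal (y ^ (Module.finrank ℝ E - 1)) * f y := by
  calc
    ∫⁻ x, f (‖x‖) ∂μ = ∫⁻ x : ({(0)}ᶜ : Set E), f (‖x.1‖) ∂(μ.comap (↑)) := by
      rw [lintegral_subtype_comap (measurableSet_singleton _).compl fun x ↦ f (‖x‖),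
        restrict_compl_singleton]
    _ = ∫⁻ x, f x.2 ∂μ.toSphere.prod (.volumeIoiPow (Module.finrank ℝ E - 1)) := by
      simpa using μ.measurePreserving_homeomorphUnitSphereProd.lintegral_comp_emb
        (Homeomorph.measurableEmbedding _) (f ∘ Subtype.val ∘ Prod.snd)
    _ = μ.toSphere Set.univ * ∫⁻ x : Set.Ioi (0 : ℝ), f x ∂.volumeIoiPow (Module.finrank ℝ E - 1) := by
      rw [lintegral_prod _ (by fun_prop)]
      simp [mul_comm]
    _ = _ := by
      simp only [Measure.volumeIoiPow]
      rw [lintegral_withDensity_eq_lintegral_mul _ (by fun_prop) (by fun_prop)]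
      rw [← lintegral_subtype_comap measurableSet_Ioi]
      rfl

theorem norm_split (d : ℕ) (y : EuclideanSpace ℝ (Fin (d+1))) :
    ‖y‖ = Real.sqrt ((y 0)^2 + ‖(WithLp.toLp 2 (fun i : Fin d => y i.succ) : EuclideanSpace ℝ (Fin d))‖^2) := by
  rw [EuclideanSpace.norm_eq, EuclideanSpace.norm_sq_eq, Fin.sum_univ_succ]
  simp

/-- integrating functions of first coordinate and norm of the rest -/
theorem lintegral_split (d : ℕ) (hd : 1 ≤ d) : ∃ C : ENNReal, 
    ∀ G : ℝ × ℝ → ENNReal, Measurable G →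
    ∫⁻ y : EuclideanSpace ℝ (Fin (d+1)), G (y 0, ‖y‖) =
    C * ∫⁻ p : ℝ × ℝ, (Set.Ioi (0:ℝ)).indicator (fun r => ENNReal.ofReal (r ^ (d-1))) p.2
        * G (p.1, Real.sqrt (p.1^2 + p.2^2)) := by
  obtain ⟨e, rfl⟩ : ∃ e, d = e + 1 := ⟨d - 1, by omega⟩
  set F := EuclideanSpace ℝ (Fin (e+1))
  refine ⟨(volume : Measure F).toSphere Set.univ, fun G hG => ?_⟩
  have h1 := (EuclideanSpace.volume_preserving_symm_measurableEquiv_toLp (Fin (e+1+1)))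
  have h2 := (volume_preserving_piFinSuccAbove (fun _ : Fin (e+1+1) => ℝ) 0)
  have h3 := (EuclideanSpace.volume_preserving_symm_measurableEquiv_toLp (Fin (e+1)))
  have h3' : MeasurePreserving (Prod.map id (MeasurableEquiv.toLp 2 (Fin (e+1) → ℝ)) : ℝ × _ → ℝ × F) :=
    (MeasurePreserving.id volume).prod h3.symm
  have h := h3'.comp (h2.comp h1)
  have key := h.lintegral_comp (f := fun q : ℝ × F => G (q.1, Real.sqrt (q.1^2 + ‖q.2‖^2))) (by fun_prop)
  have e1 : ∫⁻ y : EuclideanSpace ℝ (Fin (e+1+1)), G (y 0, ‖y‖) = ∫⁻ q : ℝ × F, G (q.1, Real.sqrt (q.1^2 + ‖q.2‖^2)) := by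
    rw [← key]
    congr 1 with y
    rw [norm_split]
    rfl
  rw [e1, Measure.volume_eq_prod, lintegral_prod _ (by fun_prop), Measure.volume_eq_prod, lintegral_prod]
  · rw [← lintegral_const_mul]
    · congr 1 with a
      rw [radial_lintegral volume (fun r => G (a, Real.sqrt (a^2 + r^2))) (by fun_prop)]
      congr 1
      rw [← lintegral_indicator measurableSet_Ioi]
      congr 1 with r
      by_cases hr : 0 < r <;> simp [hr, F]
    · apply Measurable.lintegral_prod_right'
        (f := fun p : ℝ × ℝ => (Set.Ioi (0:ℝ)).indicator (fun r => ENNReal.ofReal (r ^ (e+1-1))) p.2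
        * G (p.1, Real.sqrt (p.1^2 + p.2^2)))
      have : Measurable ((Set.Ioi (0:ℝ)).indicator (fun r => ENNReal.ofReal (r ^ (e+1-1)))) := 
        Measurable.indicator (by fun_prop) measurableSet_Ioi
      fun_prop
  · have : Measurable ((Set.Ioi (0:ℝ)).indicator (fun r => ENNReal.ofReal (r ^ (e+1-1)))) := 
        Measurable.indicator (by fun_prop) measurableSet_Ioi
    fun_prop

theorem lintegral_polar (d : ℕ) (hd : 1 ≤ d) : ∃ C : ENNReal, ∀ f : ℝ → ENNReal, Measurable f →
    ∫⁻ y in Metric.ball (0 : EuclideanSpace ℝ (Fin (d+1))) 1, f (‖y‖⁻¹ * y 0) =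
    C * ∫⁻ θ in Set.Ioo 0 Real.pi, ENNReal.ofReal (Real.sin θ ^ (d-1)) * f (Real.cos θ) := by
  obtain ⟨C, hC⟩ := lintegral_split d hd
  refine ⟨C * ∫⁻ R in Set.Ioi (0:ℝ), ENNReal.ofReal R * (ENNReal.ofReal (R^(d-1)) * (Set.Iio 1).indicator 1 R), fun f hf => ?_⟩
  have hI : Measurable ((Set.Iio (1:ℝ)).indicator (1 : ℝ → ENNReal)) := 
        Measurable.indicator (by fun_prop) measurableSet_Iio
  have hI2 : Measurable ((Set.Ioi (0:ℝ)).indicator (fun r => ENNReal.ofReal (r ^ (d-1)))) := 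
        Measurable.indicator (by fun_prop) measurableSet_Ioi
  have := hC (fun p => (Set.Iio (1:ℝ)).indicator 1 p.2 * f (p.2⁻¹ * p.1)) (by fun_prop)
  rw [← lintegral_indicator Metric.isOpen_ball.measurableSet]
  have e1 : ∀ y : EuclideanSpace ℝ (Fin (d+1)), (Metric.ball 0 1).indicator (fun y => f (‖y‖⁻¹ * y 0)) y 
      = (Set.Iio (1:ℝ)).indicator 1 ‖y‖ * f (‖y‖⁻¹ * y 0) := by
    intro y
    by_cases hy : ‖y‖ < 1 <;> simp [hy]
  simp_rw [e1]
  rw [this, ← lintegral_comp_polarCoord_symm, mul_assoc]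
  congr 1
  have tgt : polarCoord.target = Set.Ioi 0 ×ˢ Set.Ioo (-Real.pi) Real.pi := rfl
  rw [tgt, Measure.volume_eq_prod, ← Measure.prod_restrict, ← lintegral_indicator measurableSet_Ioo]
  have : Measurable ((Set.Ioo 0 Real.pi).indicator fun θ => ENNReal.ofReal (Real.sin θ ^ (d-1)) * f (Real.cos θ)) := 
    Measurable.indicator (by fun_prop) measurableSet_Ioo
  have e2 : ∫⁻ θ, ((Set.Ioo 0 Real.pi).indicator fun θ => ENNReal.ofReal (Real.sin θ ^ (d-1)) * f (Real.cos θ)) θ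
     = ∫⁻ θ in Set.Ioo (-Real.pi) Real.pi, ((Set.Ioo 0 Real.pi).indicator fun θ => ENNReal.ofReal (Real.sin θ ^ (d-1)) * f (Real.cos θ)) θ := by
    rw [lintegral_indicator measurableSet_Ioo, lintegral_indicator measurableSet_Ioo, Measure.restrict_restrict measurableSet_Ioo]
    congr 2
    ext t
    have := Real.pi_pos
    simp only [Set.mem_Ioo, Set.mem_inter_iff]
    constructor
    · rintro ⟨h1, h2⟩
      refine ⟨⟨h1, h2⟩, by linarith, h2⟩
    · rintro ⟨h1, h2⟩
      exact h1
  rw [e2, ← lintegral_prod_mul (by fun_prop) (by fun_prop)]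
  rw [Measure.prod_restrict]
  apply setLIntegral_congr_fun (measurableSet_Ioi.prod measurableSet_Ioo)
  rintro ⟨R, θ⟩ ⟨hR, hθ⟩
  simp only [polarCoord_symm_apply, smul_eq_mul]
  have hR : 0 < R := hR
  have hθ1 : -Real.pi < θ := hθ.1
  have hθ2 : θ < Real.pi := hθ.2
  have s1 : Real.sqrt ((R * Real.cos θ)^2 + (R * Real.sin θ)^2) = R := by
    rw [show (R * Real.cos θ)^2 + (R * Real.sin θ)^2 = R^2 * (Real.cos θ ^2 + Real.sin θ^2) by ring]
    rw [Real.cos_sq_add_sin_sq, mul_one, Real.sqrt_sq hR.le]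
  rw [s1, inv_mul_cancel_left₀ hR.ne']
  by_cases h0 : 0 < θ
  · have hs : 0 < Real.sin θ := Real.sin_pos_of_pos_of_lt_pi h0 hθ2
    have : 0 < R * Real.sin θ := by positivity
    simp only [Set.indicator, Set.mem_Ioi, this, Set.mem_Ioo, h0, hθ2, and_self, if_true, mul_pow]
    rw [ENNReal.ofReal_mul (by positivity)]
    ring
  · have hs : Real.sin θ ≤ 0 := Real.sin_nonpos_of_nonpos_of_neg_pi_le (by linarith) (by linarith)
    have : ¬ 0 < R * Real.sin θ := by nlinarith
    simp [Set.indicator, this, h0]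

theorem exists_isometry_unit (d : ℕ) (x : EuclideanSpace ℝ (Fin (d+1))) (hx : ‖x‖ = 1) :
    ∃ L : EuclideanSpace ℝ (Fin (d+1)) ≃ₗᵢ[ℝ] EuclideanSpace ℝ (Fin (d+1)),
      ∀ y, inner ℝ x (L y) = y 0 := by
  set e : EuclideanSpace ℝ (Fin (d+1)) := EuclideanSpace.single 0 1
  have he : ‖e‖ = ‖x‖ := by simp [e, hx]
  refine ⟨(ℝ ∙ (e - x))ᗮ.reflection, fun y => ?_⟩
  have h := (ℝ ∙ (e - x))ᗮ.reflection.inner_map_map e y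
  rw [Submodule.reflection_sub he] at h
  rw [h]
  simp [e, EuclideanSpace.inner_single_left]

/-- normalised surface measure on the sphere, with Funk-Hecke formula -/
theorem exists_sphere_measure (d : ℕ) (hd : 1 ≤ d) :
    ∃ σ : Measure (EuclideanSpace ℝ (Fin (d+1))), IsProbabilityMeasure σ ∧
      (∀ᵐ y ∂σ, ‖y‖ = 1) ∧
      ∀ x : EuclideanSpace ℝ (Fin (d+1)), ‖x‖ = 1 → ∀ f : ℝ → ℝ, Continuous f →
        ∫ y, f (inner ℝ x y) ∂σ =
          (∫ θ in 0..Real.pi, Real.sin θ ^ (d-1))⁻¹ *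
          ∫ θ in 0..Real.pi, f (Real.cos θ) * Real.sin θ ^ (d-1) := by
  obtain ⟨C, hC⟩ := lintegral_polar d hd
  set E := EuclideanSpace ℝ (Fin (d+1))
  set μ : Measure E := volume.restrict (Metric.ball 0 1)
  set V : ENNReal := volume (Metric.ball (0:E) 1)
  have hV0 : V ≠ 0 := (Metric.measure_ball_pos _ _ one_pos).ne'
  have hVt : V ≠ ⊤ := measure_ball_lt_top.ne
  set π : E → E := fun y => ‖y‖⁻¹ • y
  have hπ : Measurable π := by fun_prop
  set σ : Measure E := (V⁻¹ • μ).map π with hσ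
  set ν : Measure ℝ := ((volume.restrict (Set.Ioo 0 Real.pi)).withDensity
    (fun θ => ENNReal.ofReal (Real.sin θ ^ (d-1)))).map Real.cos with hν
  have hprob : IsProbabilityMeasure σ := by
    constructor
    rw [hσ, Measure.map_apply hπ MeasurableSet.univ]
    simp [μ]
    exact ENNReal.inv_mul_cancel hV0 hVt
  have hmap : ∀ x : E, ‖x‖ = 1 → σ.map (fun y => inner ℝ x y) = (V⁻¹ * C) • ν := by
    intro x hx
    refine Measure.ext_of_lintegral _ fun f hf => ?_
    obtain ⟨L, hL⟩ := exists_isometry_unit d x hx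
    rw [lintegral_map hf (by fun_prop), hσ, lintegral_map (by fun_prop) hπ, lintegral_smul_measure,
      lintegral_smul_measure, hν, lintegral_map hf (by fun_prop),
      lintegral_withDensity_eq_lintegral_mul _ (by fun_prop) (by fun_prop)]
    have := hC f hf
    simp only [smul_eq_mul, mul_assoc]
    congr 1
    simp only [Pi.mul_apply]
    rw [← this]
    have hLp := L.measurePreserving
    have h2 := hLp.setLIntegral_comp_preimage (s := Metric.ball 0 1) Metric.isOpen_ball.measurableSet
      (f := fun y => f (inner ℝ x (π y))) (by fun_prop)
    rw [← h2]
    have h3 : L ⁻¹' Metric.ball 0 1 = Metric.ball 0 1 := by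
      ext y; simp
    rw [h3]
    congr 1 with y
    have hn : ‖L y‖ = ‖y‖ := L.norm_map y
    simp only [π, inner_smul_right, hL, hn]
  have hintg : ∀ g : ℝ → ℝ, Continuous g → ∫ u, g u ∂ν = ∫ θ in 0..Real.pi, g (Real.cos θ) * Real.sin θ ^ (d-1) := by
    intro g hg
    rw [hν, integral_map (by fun_prop) (by exact hg.measurable.aestronglyMeasurable),
      intervalIntegral.integral_of_le Real.pi_pos.le, integral_Ioc_eq_integral_Ioo]
    have : (fun θ => ENNReal.ofReal (Real.sin θ ^ (d-1))) = fun θ => ((Real.toNNReal (Real.sin θ ^ (d-1)) : NNReal) : ENNReal) := rfl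
    rw [this, integral_withDensity_eq_integral_smul (by fun_prop)]
    apply setIntegral_congr_fun measurableSet_Ioo
    intro θ hθ
    have : 0 ≤ Real.sin θ := Real.sin_nonneg_of_nonneg_of_le_pi hθ.1.le hθ.2.le
    simp only [NNReal.smul_def, smul_eq_mul]
    rw [Real.coe_toNNReal _ (by positivity), mul_comm]
  have hform : ∀ x : E, ‖x‖ = 1 → ∀ f : ℝ → ℝ, Continuous f →
      ∫ y, f (inner ℝ x y) ∂σ = (V⁻¹ * C).toReal * ∫ θ in 0..Real.pi, f (Real.cos θ) * Real.sin θ ^ (d-1) := by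
    intro x hx f hf
    rw [← hintg f hf, ← smul_eq_mul, ← integral_smul_measure, ← hmap x hx, integral_map (by fun_prop) hf.measurable.aestronglyMeasurable]
  have hone := hform (EuclideanSpace.single 0 1) (by simp [E]) (fun _ => 1) continuous_const
  simp only [integral_const, probReal_univ, smul_eq_mul, one_mul] at hone
  refine ⟨σ, hprob, ?_, ?_⟩
  · rw [hσ, ae_map_iff hπ.aemeasurable (measurableSet_eq_fun (by fun_prop) (by fun_prop))]
    apply Measure.ae_smul_measure
    have : ∀ᵐ y ∂μ, y ≠ 0 := by
      apply ae_restrict_of_ae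
      simp [ae_iff]
    filter_upwards [this] with y hy
    have : ‖y‖ ≠ 0 := norm_ne_zero_iff.mpr hy
    simp only [π, norm_smul, norm_inv, norm_norm]
    field_simp
    exact (norm_norm y).symm
  · intro x hx f hf
    rw [hform x hx f hf]
    congr 1
    exact eq_inv_of_mul_eq_one_left hone.symm


theorem inner_pow_expand (d k : ℕ) (x y : EuclideanSpace ℝ (Fin (d+1))) :
    (inner ℝ x y : ℝ) ^ k = ∑ α : Fin k → Fin (d+1), (∏ l, x (α l)) * (∏ l, y (α l)) := by
  have : (inner ℝ x y : ℝ) = ∑ i, x i * y i := by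
    simp [PiLp.inner_apply, mul_comm]
  rw [this, Fintype.sum_pow]
  simp [Finset.prod_mul_distrib]

theorem monomial_integrable (d k : ℕ) (σ : Measure (EuclideanSpace ℝ (Fin (d+1))))
    [IsProbabilityMeasure σ] (hae : ∀ᵐ y ∂σ, ‖y‖ = 1) (α : Fin k → Fin (d+1)) :
    Integrable (fun y : EuclideanSpace ℝ (Fin (d+1)) => ∏ l, y (α l)) σ := by
  refine Integrable.of_bound (C := 1) (Measurable.aestronglyMeasurable (by fun_prop)) ?_
  filter_upwards [hae] with y hy
  rw [norm_prod]
  apply Finset.prod_le_one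
  · intros; positivity
  · intro i _
    rw [← hy]
    exact PiLp.norm_apply_le y (α i)

theorem pow_energy (d k : ℕ) (σ : Measure (EuclideanSpace ℝ (Fin (d+1))))
    [IsProbabilityMeasure σ] (hae : ∀ᵐ y ∂σ, ‖y‖ = 1) (A : ℝ)
    (hA : ∀ x : EuclideanSpace ℝ (Fin (d+1)), ‖x‖ = 1 → ∫ y, (inner ℝ x y : ℝ) ^ k ∂σ = A)
    {N : ℕ} (x : Fin N → EuclideanSpace ℝ (Fin (d+1))) (hx : ∀ i, ‖x i‖ = 1) :
    (N:ℝ)^2 * A ≤ ∑ i, ∑ j, (inner ℝ (x i) (x j) : ℝ) ^ k := by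
  set m : (Fin k → Fin (d+1)) → ℝ := fun α => ∫ y, ∏ l, y (α l) ∂σ with hm
  set s : (Fin k → Fin (d+1)) → ℝ := fun α => ∑ i, ∏ l, x i (α l) with hs
  have h1 : ∀ x : EuclideanSpace ℝ (Fin (d+1)), ‖x‖ = 1 → ∑ α : Fin k → Fin (d+1), (∏ l, x (α l)) * m α = A := by
    intro x hx
    rw [← hA x hx]
    simp_rw [inner_pow_expand]
    rw [integral_finsetSum]
    · simp_rw [integral_const_mul]
      rfl
    · intro α _
      exact (monomial_integrable d k σ hae α).const_mul _
  have h2 : ∑ α, m α * m α = A := by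
    have : ∫ y : EuclideanSpace ℝ (Fin (d+1)), ∑ α : Fin k → Fin (d+1), (∏ l, y (α l)) * m α ∂σ = A := by
      rw [integral_congr_ae (g := fun _ => A)]
      · simp
      · filter_upwards [hae] with y hy using h1 y hy
    rw [integral_finsetSum] at this
    · simp_rw [integral_mul_const] at this
      exact this
    · intro α _
      exact (monomial_integrable d k σ hae α).mul_const _
  have h3 : ∑ α, s α * m α = N * A := by
    simp only [hs, Finset.sum_mul]
    rw [Finset.sum_comm]
    rw [Finset.sum_congr rfl (fun i _ => h1 (x i) (hx i))]
    simp
  have h4 : ∑ i, ∑ j, (inner ℝ (x i) (x j) : ℝ) ^ k = ∑ α, s α * s α := by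
    simp_rw [inner_pow_expand, hs, Finset.sum_mul_sum]
    rw [Finset.sum_congr rfl (fun i _ => Finset.sum_comm)]
    rw [Finset.sum_comm]
  have h5 : 0 ≤ ∑ α, (s α - N * m α)^2 := Finset.sum_nonneg (fun _ _ => sq_nonneg _)
  have h6 : ∑ α, (s α - N * m α)^2 = ∑ α, s α * s α - 2 * N * ∑ α, s α * m α + N^2 * ∑ α, m α * m α := by
    simp only [Finset.mul_sum, ← Finset.sum_sub_distrib, ← Finset.sum_add_distrib]
    exact Finset.sum_congr rfl (fun _ _ => by ring)
  rw [h4]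
  rw [h6, h2, h3] at h5
  nlinarith

theorem abs_inner_le_one' {d : ℕ} {x y : EuclideanSpace ℝ (Fin (d+1))} (hx : ‖x‖ = 1) (hy : ‖y‖ = 1) :
    |(inner ℝ x y : ℝ)| ≤ 1 := by
  have := abs_real_inner_le_norm x y
  rwa [hx, hy, one_mul] at this

theorem series_energy (d : ℕ) (σ : Measure (EuclideanSpace ℝ (Fin (d+1))))
    [IsProbabilityMeasure σ] (hae : ∀ᵐ y ∂σ, ‖y‖ = 1) (A : ℕ → ℝ)
    (hA : ∀ k, ∀ x : EuclideanSpace ℝ (Fin (d+1)), ‖x‖ = 1 → ∫ y, (inner ℝ x y : ℝ) ^ k ∂σ = A k)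
    (f : ℝ → ℝ) (a : ℕ → ℝ) (ha : ∀ k, 0 ≤ a k) (hf : ∀ u : ℝ, |u| ≤ 1 → HasSum (fun k => a k * u ^ k) (f u))
    (J : ℝ) (hJ : ∀ x : EuclideanSpace ℝ (Fin (d+1)), ‖x‖ = 1 → ∫ y, f (inner ℝ x y) ∂σ = J)
    {N : ℕ} (x : Fin N → EuclideanSpace ℝ (Fin (d+1))) (hx : ∀ i, ‖x i‖ = 1) :
    (N:ℝ)^2 * J ≤ ∑ i, ∑ j, f (inner ℝ (x i) (x j)) := by
  have hsum : Summable a := by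
    have := (hf 1 (by simp)).summable
    simpa using this
  have hJs : HasSum (fun k => a k * A k) J := by
    set e : EuclideanSpace ℝ (Fin (d+1)) := EuclideanSpace.single 0 1
    have he : ‖e‖ = 1 := by simp [e]
    have hb : ∀ k, ∀ᵐ y ∂σ, ‖a k * (inner ℝ e y : ℝ)^k‖ ≤ a k := by
      intro k
      filter_upwards [hae] with y hy
      rw [norm_mul, norm_pow, Real.norm_eq_abs, abs_of_nonneg (ha k)]
      exact mul_le_of_le_one_right (ha k) (pow_le_one₀ (by positivity) (abs_inner_le_one' he hy))
    have := hasSum_integral_of_dominated_convergence (μ := σ) 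
      (F := fun k y => a k * (inner ℝ e y : ℝ)^k) (f := fun y => f (inner ℝ e y)) (fun k _ => a k)
      (fun k => Measurable.aestronglyMeasurable (by fun_prop)) hb (by simp [hsum])
      (by simp) (by
        filter_upwards [hae] with y hy
        exact hf _ (abs_inner_le_one' he hy))
    rw [hJ e he] at this
    simp_rw [integral_const_mul, hA _ e he] at this
    exact this
  have h2 : HasSum (fun k => ∑ i, ∑ j, a k * (inner ℝ (x i) (x j) : ℝ)^k) (∑ i, ∑ j, f (inner ℝ (x i) (x j))) :=
    hasSum_sum (fun i _ => hasSum_sum (fun j _ => hf _ (abs_inner_le_one' (hx i) (hx j))))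
  refine hasSum_le (fun k => ?_) (hJs.mul_left ((N:ℝ)^2)) h2
  have := pow_energy d k σ hae (A k) (hA k) x hx
  simp_rw [← Finset.mul_sum]
  have := mul_le_mul_of_nonneg_left this (ha k)
  linarith

theorem choose_nonneg (s : ℝ) (hs : 0 < s) (n : ℕ) : 0 ≤ Ring.choose (s + n - 1) n := by
  rw [← Ring.multichoose_eq]
  have h := Ring.factorial_nsmul_multichoose_eq_ascPochhammer s n
  rw [Polynomial.ascPochhammer_smeval_eq_eval, nsmul_eq_mul] at h
  have h2 := ascPochhammer_pos n s hs
  rw [← h] at h2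
  exact (pos_of_mul_pos_right h2 (by positivity)).le

theorem kernel_series (s ε : ℝ) (hs : 0 < s) (hε : 0 < ε) : ∃ a : ℕ → ℝ, (∀ k, 0 ≤ a k) ∧
    ∀ u : ℝ, |u| ≤ 1 → HasSum (fun k => a k * u ^ k) (((2 + ε - 2 * u) ^ s)⁻¹) := by
  set ρ : ℝ := 2 / (2 + ε) with hρ
  have hρ0 : 0 < ρ := by positivity
  have hρ1 : ρ < 1 := by rw [hρ, div_lt_one (by positivity)]; linarith
  refine ⟨fun k => ((2 + ε)^s)⁻¹ * (Ring.choose (s + k - 1) k * ρ^k), fun k => ?_, fun u hu => ?_⟩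
  · have := choose_nonneg s hs k
    positivity
  · have h := (Real.one_div_one_sub_rpow_hasFPowerSeriesOnBall_zero s).hasSum (y := ρ * u) (by
      have : |ρ * u| < 1 := by
        rw [abs_mul, abs_of_pos hρ0]; nlinarith [abs_nonneg u]
      rw [Metric.mem_eball, edist_zero_right, Real.enorm_eq_ofReal_abs]
      exact ENNReal.ofReal_lt_one.mpr this)
    simp only [FormalMultilinearSeries.ofScalars_apply_eq, zero_add] at h
    have h2 := h.mul_left (((2 + ε)^s)⁻¹)
    have hpos : 0 < 1 - ρ * u := by nlinarith [abs_le.mp hu]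
    have e1 : (fun k => (((2 + ε)^s)⁻¹ * (Ring.choose (s + (k:ℕ) - 1) k * ρ^k)) * u ^ k) =
        fun i => ((2 + ε) ^ s)⁻¹ * Ring.choose (s + ↑i - 1) i • (ρ * u) ^ i := by
      ext k
      rw [smul_eq_mul, mul_pow]; ring
    have e2 : ((2 + ε - 2 * u) ^ s)⁻¹ = ((2 + ε) ^ s)⁻¹ * (1 / (1 - ρ * u) ^ s) := by
      rw [one_div, ← mul_inv, ← Real.mul_rpow (by positivity) hpos.le]
      congr 2
      rw [hρ]; field_simp
    simp only [e2]
    rw [e1]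
    exact h2


theorem chord_sq (θ : ℝ) : 2 - 2 * Real.cos θ = (2 * Real.sin (θ/2))^2 := by
  have := Real.cos_sq (θ/2)
  rw [show 2 * (θ/2) = θ by ring] at this
  have := Real.sin_sq_add_cos_sq (θ/2)
  nlinarith

theorem chord_eq (θ : ℝ) (h0 : 0 ≤ θ) (h1 : θ ≤ Real.pi) :
    Real.sqrt (2 - 2 * Real.cos θ) = 2 * Real.sin (θ/2) := by
  rw [chord_sq, Real.sqrt_sq]
  have := Real.sin_nonneg_of_nonneg_of_le_pi (x := θ/2) (by linarith) (by linarith)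
  positivity

theorem upper_integral (d : ℕ) (hd : 1 ≤ d) (δ : ℝ) (h0 : 0 < δ) (h1 : δ ≤ 1) :
    ∫ θ in 0..Real.pi, ((max (Real.sqrt (2 - 2 * Real.cos θ)) δ)^d)⁻¹ * Real.sin θ ^ (d-1)
      ≤ 1 + Real.log 4 - Real.log δ := by
  obtain ⟨e, rfl⟩ : ∃ e, d = e + 1 := ⟨d - 1, by omega⟩
  simp only [Nat.add_sub_cancel]
  have hpi := Real.pi_gt_three
  set F : ℝ → ℝ := fun θ => ((max (Real.sqrt (2 - 2 * Real.cos θ)) δ)^(e+1))⁻¹ * Real.sin θ ^ e with hF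
  have hm : ∀ θ, 0 < max (Real.sqrt (2 - 2 * Real.cos θ)) δ := fun θ => lt_max_of_lt_right h0
  have hcont : Continuous F := by
    apply Continuous.mul _ (by fun_prop)
    apply Continuous.inv₀ (by fun_prop)
    intro θ
    exact (pow_pos (hm θ) _).ne'
  have hii : ∀ a b, IntervalIntegrable F volume a b := fun a b => hcont.intervalIntegrable a b
  rw [← intervalIntegral.integral_add_adjacent_intervals (hii 0 δ) (hii δ Real.pi)]
  have p1 : ∫ θ in 0..δ, F θ ≤ 1 := by
    have : ∫ θ in 0..δ, F θ ≤ ∫ θ in 0..δ, (1/δ) := by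
      apply intervalIntegral.integral_mono_on h0.le (hii _ _) (by simp)
      intro θ hθ
      have s0 : 0 ≤ Real.sin θ := Real.sin_nonneg_of_nonneg_of_le_pi hθ.1 (by linarith [hθ.2])
      have s1 : Real.sin θ ≤ δ := (Real.sin_le hθ.1).trans hθ.2
      calc F θ ≤ (δ^(e+1))⁻¹ * δ^e := by
            simp only [hF]
            gcongr
            exact le_max_right _ _
        _ = 1/δ := by rw [pow_succ]; field_simp
    refine this.trans ?_
    simp [h0.ne']
  have p2 : ∫ θ in δ..Real.pi, F θ ≤ Real.log 4 - Real.log δ := by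
    have hd : ∀ θ ∈ Set.uIcc δ Real.pi, HasDerivAt (fun θ => Real.log (Real.tan (θ/4))) (1 / (2 * Real.sin (θ/2))) θ := by
      intro θ hθ
      rw [Set.uIcc_of_le (by linarith)] at hθ
      have c : 0 < Real.cos (θ/4) := Real.cos_pos_of_mem_Ioo ⟨by linarith [hθ.1], by linarith [hθ.2]⟩
      have s : 0 < Real.sin (θ/4) := Real.sin_pos_of_pos_of_lt_pi (by linarith [hθ.1]) (by linarith [hθ.2])
      have t : Real.tan (θ/4) ≠ 0 := by rw [Real.tan_eq_sin_div_cos]; positivity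
      have h0 : HasDerivAt (fun θ : ℝ => Real.tan (θ/4)) (1 / Real.cos (θ/4)^2 * (1/4)) θ :=
        HasDerivAt.comp (h₂ := Real.tan) (h := fun x : ℝ => x/4) θ (Real.hasDerivAt_tan c.ne')
          ((hasDerivAt_id' θ).div_const 4)
      refine (h0.log t).congr_deriv ?_
      rw [Real.tan_eq_sin_div_cos, show θ/2 = 2 * (θ/4) by ring, Real.sin_two_mul]
      field_simp
      norm_num
    have hcon : ContinuousOn (fun θ => 1 / (2 * Real.sin (θ/2))) (Set.uIcc δ Real.pi) := by
      apply ContinuousOn.div (by fun_prop) (by fun_prop)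
      intro θ hθ
      rw [Set.uIcc_of_le (by linarith)] at hθ
      have s : 0 < Real.sin (θ/2) := Real.sin_pos_of_pos_of_lt_pi (by linarith [hθ.1]) (by linarith [hθ.2])
      positivity
    have hi := intervalIntegral.integral_eq_sub_of_hasDerivAt hd hcon.intervalIntegrable
    have : ∫ θ in δ..Real.pi, F θ ≤ ∫ θ in δ..Real.pi, 1 / (2 * Real.sin (θ/2)) := by
      apply intervalIntegral.integral_mono_on (by linarith) (hii _ _) hcon.intervalIntegrable
      intro θ hθ
      have hs : 0 < Real.sin (θ/2) := Real.sin_pos_of_pos_of_lt_pi (by linarith [hθ.1]) (by linarith [hθ.2])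
      have hc : 0 ≤ Real.cos (θ/2) := Real.cos_nonneg_of_mem_Icc ⟨by linarith [hθ.1], by linarith [hθ.2]⟩
      have e1 : Real.sin θ = 2 * Real.sin (θ/2) * Real.cos (θ/2) := by
        rw [← Real.sin_two_mul]; ring_nf
      have s1 : Real.sin θ ≤ 2 * Real.sin (θ/2) := by
        rw [e1]; nlinarith [Real.cos_le_one (θ/2)]
      have s0 : 0 ≤ Real.sin θ := by rw [e1]; positivity
      calc F θ ≤ ((2 * Real.sin (θ/2))^(e+1))⁻¹ * (2 * Real.sin (θ/2))^e := by
            simp only [hF]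
            gcongr
            rw [chord_eq θ (by linarith [hθ.1]) hθ.2]
            exact le_max_left _ _
        _ = 1 / (2 * Real.sin (θ/2)) := by rw [pow_succ]; field_simp
    refine this.trans ?_
    rw [hi, Real.tan_pi_div_four, Real.log_one]
    have : Real.log (δ/4) ≤ Real.log (Real.tan (δ/4)) := by
      apply Real.log_le_log (by positivity)
      exact (Real.lt_tan (by positivity) (by linarith)).le
    rw [Real.log_div h0.ne' (by norm_num)] at this
    linarith
  linarith

theorem lower_integral (d : ℕ) (hd : 1 ≤ d) (b : ℝ) (h0 : 0 < b) (h1 : b ≤ 1) :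
    - Real.log b - d ≤ 
    ∫ θ in 0..Real.pi, ((2 + b^2 - 2 * Real.cos θ)^((d:ℝ)/2))⁻¹ * Real.sin θ ^ (d-1) := by
  obtain ⟨e, rfl⟩ : ∃ e, d = e + 1 := ⟨d - 1, by omega⟩
  simp only [Nat.add_sub_cancel]
  have hpi := Real.pi_gt_three
  set D : ℝ := ((e+1 : ℕ):ℝ) with hD
  have hDe : D = e + 1 := by simp [hD]
  have he0 : (0:ℝ) ≤ e := by positivity
  set F : ℝ → ℝ := fun θ => ((2 + b^2 - 2 * Real.cos θ)^(D/2))⁻¹ * Real.sin θ ^ e with hF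
  have hm : ∀ θ, 0 < 2 + b^2 - 2 * Real.cos θ := fun θ => by nlinarith [Real.cos_le_one θ, sq_pos_of_pos h0]
  have hcont : Continuous F := by
    apply Continuous.mul _ (by fun_prop)
    apply Continuous.inv₀
    · apply Continuous.rpow_const (by fun_prop)
      intro θ; left; exact (hm θ).ne'
    intro θ
    exact (Real.rpow_pos_of_pos (hm θ) _).ne'
  have hii : ∀ a b, IntervalIntegrable F volume a b := fun a b => hcont.intervalIntegrable a b
  have q1 : ∫ θ in b..1, F θ ≤ ∫ θ in 0..Real.pi, F θ := by
    apply intervalIntegral.integral_mono_interval h0.le h1 (by linarith) _ (hii _ _)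
    refine (ae_restrict_iff' measurableSet_Ioc).mpr (Eventually.of_forall fun θ hθ => ?_)
    have s0 : 0 ≤ Real.sin θ := Real.sin_nonneg_of_nonneg_of_le_pi hθ.1.le hθ.2
    have := Real.rpow_pos_of_pos (hm θ) (D/2)
    simp only [hF, Pi.zero_apply]
    positivity
  have hd : ∀ θ ∈ Set.uIcc b 1, HasDerivAt (fun θ => Real.log θ - D * θ^2/2 + D/4 * b^2 * (θ^2)⁻¹) 
      (θ⁻¹ - D * θ - D/2*b^2 * (θ^3)⁻¹) θ := by
    intro θ hθ
    rw [Set.uIcc_of_le (by linarith)] at hθ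
    have hθ0 : 0 < θ := by linarith [hθ.1]
    refine HasDerivAt.congr_deriv (((Real.hasDerivAt_log hθ0.ne').sub (((hasDerivAt_pow 2 θ).const_mul D).div_const 2)).add
      (((hasDerivAt_pow 2 θ).inv (by positivity)).const_mul (D/4 * b^2))) ?_
    field_simp
    ring
  have hcon : ContinuousOn (fun θ => θ⁻¹ - D * θ - D/2*b^2 * (θ^3)⁻¹) (Set.uIcc b 1) := by
    intro θ hθ
    rw [Set.uIcc_of_le (by linarith)] at hθ
    have hθ0 : 0 < θ := by linarith [hθ.1]
    apply ContinuousAt.continuousWithinAt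
    have : θ ≠ 0 := hθ0.ne'
    have : θ^3 ≠ 0 := by positivity
    fun_prop (disch := assumption)
  have hi := intervalIntegral.integral_eq_sub_of_hasDerivAt hd hcon.intervalIntegrable
  have q2 : ∫ θ in b..1, (θ⁻¹ - D * θ - D/2*b^2 * (θ^3)⁻¹) ≤ ∫ θ in b..1, F θ := by
    apply intervalIntegral.integral_mono_on (by linarith) hcon.intervalIntegrable (hii _ _)
    intro θ hθ
    have hθ0 : 0 < θ := by linarith [hθ.1]
    set z := b^2/θ^2 with hz
    have hz0 : 0 < z := by positivity
    set B := ((1 + z)^(D/2))⁻¹ with hB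
    have hB1 : B ≤ 1 := by
      apply inv_le_one_of_one_le₀
      exact Real.one_le_rpow (by linarith) (by positivity)
    have hB2 : 1 - D/2 * z ≤ B := by
      have : (1 + z)^(D/2) ≤ Real.exp (D/2*z) := by
        have := Real.rpow_le_rpow (by positivity) (Real.add_one_le_exp z) (show 0 ≤ D/2 by positivity)
        rw [← Real.exp_mul, add_comm, mul_comm z] at this
        exact this
      have h3 : (Real.exp (D/2*z))⁻¹ ≤ B := by
        rw [hB]; gcongr
      rw [← Real.exp_neg] at h3
      linarith [Real.add_one_le_exp (-(D/2*z))]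
    set S := (1 - θ^2/4)^e with hS
    have hθ2 : θ^2 ≤ 1 := by nlinarith [hθ.2]
    have hS1 : S ≤ 1 := pow_le_one₀ (by linarith) (by nlinarith)
    have hS2 : 1 - D * θ^2 ≤ S := by
      have := one_add_mul_le_pow (a := -(θ^2/4)) (by linarith) e
      rw [hS, hDe]
      have e2 : (1:ℝ) + -(θ^2/4) = 1 - θ^2/4 := by ring
      rw [e2] at this
      nlinarith [sq_nonneg θ]
    have hS0 : 0 ≤ S := pow_nonneg (by linarith) _
    have hsin : θ * (1 - θ^2/4) ≤ Real.sin θ := by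
      have := Real.sin_gt_sub_cube hθ0
      have : 0 < θ^3 := by positivity
      nlinarith
    have h4 : θ^e * S ≤ Real.sin θ ^ e := by
      rw [hS, ← mul_pow]
      exact pow_le_pow_left₀ (mul_nonneg hθ0.le (by linarith)) hsin _
    have h5 : (θ^(e+1))⁻¹ * B ≤ ((2 + b^2 - 2 * Real.cos θ)^(D/2))⁻¹ := by
      have h6 : θ^(e+1) = (θ^2)^(D/2) := by
        rw [← Real.rpow_natCast, ← Real.rpow_natCast, ← Real.rpow_mul hθ0.le, ← hD]
        congr 1; push_cast; ring
      rw [hB, h6, ← mul_inv, ← Real.mul_rpow (by positivity) (by positivity)]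
      have h7 : 2 + b^2 - 2 * Real.cos θ ≤ θ^2 * (1 + z) := by
        have : θ^2 * (1 + z) = θ^2 + b^2 := by rw [hz]; field_simp
        rw [this]
        linarith [Real.one_sub_sq_div_two_le_cos (x := θ)]
      have := hm θ
      have := Real.rpow_pos_of_pos (hm θ) (D/2)
      gcongr
    have hB0 : 0 ≤ B := by positivity
    calc θ⁻¹ - D * θ - D/2*b^2 * (θ^3)⁻¹ = θ⁻¹ * (1 - D * θ^2 - D/2*z) := by rw [hz]; field_simp
      _ ≤ θ⁻¹ * (B * S) := by
        gcongr
        nlinarith [mul_nonneg (sub_nonneg.mpr hB1) (sub_nonneg.mpr hS1)]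
      _ = ((θ^(e+1))⁻¹ * B) * (θ^e * S) := by rw [pow_succ]; field_simp
      _ ≤ F θ := by
        simp only [hF]
        have := Real.rpow_pos_of_pos (hm θ) (D/2)
        exact mul_le_mul h5 h4 (by positivity) (by positivity)
  have : ((1:ℝ)^2)⁻¹ = 1 := by norm_num
  rw [hi, Real.log_one, this, mul_assoc (D/4) (b^2) (b^2)⁻¹, mul_inv_cancel₀ (by positivity)] at q2
  have hb2 : 0 ≤ D * b^2 := by positivity
  have hD0 : 0 ≤ D := by positivity
  nlinarith

theorem wallis_gamma (n : ℕ) : ∫ θ in 0..Real.pi, Real.sin θ ^ n =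
    Real.sqrt Real.pi * Real.Gamma (((n:ℝ)+1)/2) / Real.Gamma ((n:ℝ)/2 + 1) := by
  induction n using Nat.twoStepInduction with
  | zero => 
    have := Real.Gamma_one_half_eq
    rw [one_div] at this
    simp [this, Real.mul_self_sqrt Real.pi_pos.le]
  | one => 
    simp only [pow_one, integral_sin, Nat.cast_one]
    rw [Real.Gamma_add_one (by norm_num), Real.Gamma_one_half_eq]
    norm_num
    field_simp
  | more n ih _ =>
    rw [integral_sin_pow, ih]
    have e1 : ((n + 2 : ℕ):ℝ) = n + 2 := by push_cast; ring
    rw [e1, show ((n:ℝ) + 2 + 1)/2 = (n+1)/2 + 1 by ring, show ((n:ℝ)+2)/2 + 1 = (n/2 + 1) + 1 by ring,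
      Real.Gamma_add_one (s := ((n:ℝ)+1)/2) (by positivity), Real.Gamma_add_one (s := (n:ℝ)/2+1) (by positivity)]
    have : 0 < Real.Gamma ((n:ℝ)/2+1) := Real.Gamma_pos_of_pos (by positivity)
    simp
    field_simp

theorem norm_sub_unit {d : ℕ} {x y : EuclideanSpace ℝ (Fin (d+1))} (hx : ‖x‖ = 1) (hy : ‖y‖ = 1) :
    ‖x - y‖ = Real.sqrt (2 - 2 * inner ℝ x y) := by
  rw [← Real.sqrt_sq (norm_nonneg (x - y)), norm_sub_sq_real, hx, hy]
  congr 1; ring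

theorem greedy (d : ℕ) (σ : Measure (EuclideanSpace ℝ (Fin (d+1))))
    [IsProbabilityMeasure σ] (hae : ∀ᵐ y ∂σ, ‖y‖ = 1) (hd : 1 ≤ d) (δ : ℝ) (hδ : 0 < δ) (J : ℝ)
    (hJ : ∀ x : EuclideanSpace ℝ (Fin (d+1)), ‖x‖ = 1 →
      ∫ y, ((max (Real.sqrt (2 - 2 * inner ℝ x y)) δ)^d)⁻¹ ∂σ = J) (n : ℕ)
    (hn : n * J < (δ^d)⁻¹) :
    ∃ x : Fin n → EuclideanSpace ℝ (Fin (d+1)), Function.Injective x ∧ (∀ i, ‖x i‖ = 1) ∧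
      ∑ i, ∑ j, (if i = j then 0 else (‖x i - x j‖^d)⁻¹) ≤ (n:ℝ)^2 * J := by
  have hm : ∀ u : ℝ, 0 < max (Real.sqrt u) δ := fun u => lt_max_of_lt_right hδ
  have hJ0 : 0 ≤ J := by
    rw [← hJ (EuclideanSpace.single 0 1) (by simp)]
    apply integral_nonneg
    intro y
    have := hm (2 - 2 * inner ℝ (EuclideanSpace.single 0 1) y)
    simp only [Pi.zero_apply]
    positivity
  induction n with
  | zero => exact ⟨Fin.elim0, fun i => i.elim0, fun i => i.elim0, by simp⟩
  | succ n ih =>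
    push_cast at hn
    obtain ⟨x, hinj, hx, hE⟩ := ih (by nlinarith)
    have hg : ∀ i, Integrable (fun y => ((max (Real.sqrt (2 - 2 * inner ℝ (x i) y)) δ)^d)⁻¹) σ := by
      intro i
      refine Integrable.of_bound (C := (δ^d)⁻¹) (Measurable.aestronglyMeasurable (by fun_prop)) ?_
      refine Eventually.of_forall fun y => ?_
      have := hm (2 - 2 * inner ℝ (x i) y)
      rw [Real.norm_of_nonneg (by positivity)]
      gcongr
      exact le_max_right _ _
    obtain ⟨y, hyn, hy⟩ := exists_notMem_null_le_integral (μ := σ)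
      (f := fun y => ∑ i, ((max (Real.sqrt (2 - 2 * inner ℝ (x i) y)) δ)^d)⁻¹)
      (integrable_finsetSum _ (fun i _ => hg i)) (N := {y | ¬ ‖y‖ = 1}) hae
    have hy1 : ‖y‖ = 1 := by simpa using hyn
    rw [integral_finsetSum _ (fun i _ => hg i), Finset.sum_congr rfl (fun i _ => hJ (x i) (hx i))] at hy
    simp only [Finset.sum_const, Finset.card_univ, Fintype.card_fin, nsmul_eq_mul] at hy
    have hfar : ∀ i, δ < ‖x i - y‖ := by
      intro i
      by_contra hcon
      push Not at hcon
      rw [norm_sub_unit (hx i) hy1] at hcon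
      have h1 : ((max (Real.sqrt (2 - 2 * inner ℝ (x i) y)) δ)^d)⁻¹ ≤ 
          ∑ i, ((max (Real.sqrt (2 - 2 * inner ℝ (x i) y)) δ)^d)⁻¹ := by
        apply Finset.single_le_sum (f := fun i => ((max (Real.sqrt (2 - 2 * inner ℝ (x i) y)) δ)^d)⁻¹) _ (Finset.mem_univ i)
        intro j _
        have := hm (2 - 2 * inner ℝ (x j) y)
        positivity
      rw [max_eq_right hcon] at h1
      nlinarith
    have hU : ∑ i, (‖x i - y‖^d)⁻¹ ≤ n * J := by
      refine le_trans (le_of_eq ?_) hy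
      refine Finset.sum_congr rfl fun i _ => ?_
      rw [← norm_sub_unit (hx i) hy1, max_eq_left (hfar i).le]
    refine ⟨Fin.cons y x, ?_, ?_, ?_⟩
    · rw [Fin.cons_injective_iff]
      refine ⟨?_, hinj⟩
      rintro ⟨i, rfl⟩
      have := hfar i
      simp at this
      linarith
    · intro i
      refine Fin.cases ?_ (fun i => ?_) i
      · simpa using hy1
      · simpa using hx i
    · rw [Fin.sum_univ_succ]
      simp_rw [Fin.sum_univ_succ (n := n)]
      simp only [Fin.cons_zero, Fin.cons_succ, if_true, Fin.succ_inj, Fin.succ_ne_zero, if_false,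
        (Fin.succ_ne_zero _).symm, zero_add, Finset.sum_add_distrib]
      have e1 : ∑ i, (‖y - x i‖^d)⁻¹ = ∑ i, (‖x i - y‖^d)⁻¹ :=
        Finset.sum_congr rfl fun i _ => by rw [norm_sub_rev]
      rw [e1]
      push_cast
      nlinarith

theorem lower_energy (d : ℕ) (σ : Measure (EuclideanSpace ℝ (Fin (d+1))))
    [IsProbabilityMeasure σ] (hae : ∀ᵐ y ∂σ, ‖y‖ = 1) (hd : 1 ≤ d) (A : ℕ → ℝ)
    (hA : ∀ k, ∀ x : EuclideanSpace ℝ (Fin (d+1)), ‖x‖ = 1 → ∫ y, (inner ℝ x y : ℝ) ^ k ∂σ = A k)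
    (b : ℝ) (hb : 0 < b) (J : ℝ)
    (hJ : ∀ x : EuclideanSpace ℝ (Fin (d+1)), ‖x‖ = 1 →
      ∫ y, ((2 + b^2 - 2 * inner ℝ x y)^((d:ℝ)/2))⁻¹ ∂σ = J) (N : ℕ)
    (x : Fin N → EuclideanSpace ℝ (Fin (d+1))) (hinj : Function.Injective x) (hx : ∀ i, ‖x i‖ = 1) :
    (N:ℝ)^2 * J - N * (b^d)⁻¹ ≤ ∑ i, ∑ j, (if i = j then 0 else (‖x i - x j‖^d)⁻¹) := by
  obtain ⟨a, ha, hs⟩ := kernel_series ((d:ℝ)/2) (b^2) (by positivity) (by positivity)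
  have h := series_energy d σ hae A hA _ a ha hs J hJ x hx
  have hpow : ∀ t : ℝ, 0 < t → (t^2)^((d:ℝ)/2) = t^d := by
    intro t ht
    rw [← Real.rpow_natCast, ← Real.rpow_natCast, ← Real.rpow_mul ht.le]
    congr 1; push_cast; ring
  have hterm : ∀ i j, ((2 + b^2 - 2 * inner ℝ (x i) (x j))^((d:ℝ)/2))⁻¹ ≤
      (if i = j then 0 else (‖x i - x j‖^d)⁻¹) + (if i = j then (b^d)⁻¹ else 0) := by
    intro i j
    by_cases hij : i = j
    · subst hij
      simp only [if_true, zero_add]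
      rw [real_inner_self_eq_norm_sq, hx i, ← hpow b hb]
      apply le_of_eq; congr 2; ring
    · simp only [hij, if_false, add_zero]
      have hp : 0 < ‖x i - x j‖ := norm_pos_iff.mpr (sub_ne_zero.mpr (fun h => hij (hinj h)))
      rw [← hpow _ hp, norm_sub_sq_real, hx i, hx j]
      have h2 : 0 < 2 - 2 * inner ℝ (x i) (x j) := by
        have := norm_sub_sq_real (x i) (x j)
        rw [hx i, hx j] at this
        have : 0 < ‖x i - x j‖^2 := by positivity
        linarith
      rw [show (1:ℝ)^2 - 2 * inner ℝ (x i) (x j) + 1^2 = 2 - 2 * inner ℝ (x i) (x j) by ring]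
      gcongr
      nlinarith
  have h3 : ∑ i, ∑ j, ((2 + b^2 - 2 * inner ℝ (x i) (x j))^((d:ℝ)/2))⁻¹ ≤
      ∑ i, ∑ j, (if i = j then 0 else (‖x i - x j‖^d)⁻¹) + N * (b^d)⁻¹ := by
    refine (Finset.sum_le_sum fun i _ => Finset.sum_le_sum fun j _ => hterm i j).trans (le_of_eq ?_)
    simp [Finset.sum_add_distrib]
  linarith

theorem minRiesz_bounds (d : ℕ) (hd : 1 ≤ d) : ∃ W : ℝ, 0 < W ∧ W = ∫ θ in 0..Real.pi, Real.sin θ ^ (d-1) ∧ 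
    (∀ N : ℕ, ∀ δ b : ℝ, 0 < δ → δ ≤ 1 → 0 < b → b ≤ 1 → 
      N * (W⁻¹ * (1 + Real.log 4 - Real.log δ)) < (δ^d)⁻¹ →
      minRieszEnergy d d N ≤ (N:ℝ)^2 * (W⁻¹ * (1 + Real.log 4 - Real.log δ)) ∧
      (N:ℝ)^2 * (W⁻¹ * (- Real.log b - d)) - N * (b^d)⁻¹ ≤ minRieszEnergy d d N) := by
  obtain ⟨σ, hprob, hae, hform⟩ := exists_sphere_measure d hd
  set W : ℝ := ∫ θ in 0..Real.pi, Real.sin θ ^ (d-1) with hW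
  have hW0 : 0 < W := integral_sin_pow_pos (d-1)
  refine ⟨W, hW0, rfl, ?_⟩
  intro N δ b hδ hδ1 hb hb1 hN
  have hcont1 : Continuous (fun u : ℝ => ((max (Real.sqrt (2 - 2 * u)) δ)^d)⁻¹) := by
    apply Continuous.inv₀ (by fun_prop)
    intro u
    exact (pow_pos (lt_max_of_lt_right hδ) _).ne'
  have hJ1 := fun x hx => hform x hx _ hcont1
  have hup := upper_integral d hd δ hδ hδ1
  have hup2 := mul_le_mul_of_nonneg_left hup (inv_pos.mpr hW0).le
  have hNn : (0:ℝ) ≤ N := by positivity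
  obtain ⟨x0, hinj0, hx0, hE0⟩ := greedy d σ hae hd δ hδ _ hJ1 N (by nlinarith)
  set S := {E : ℝ | ∃ x : Fin N → EuclideanSpace ℝ (Fin (d + 1)),
    Function.Injective x ∧ (∀ i, ‖x i‖ = 1) ∧
    E = ∑ i : Fin N, ∑ j : Fin N, if i = j then 0 else (‖x i - x j‖ ^ (d:ℝ))⁻¹} with hS
  have hm : minRieszEnergy d d N = sInf S := rfl
  have hmem : ∑ i, ∑ j, (if i = j then 0 else (‖x0 i - x0 j‖^d)⁻¹) ∈ S :=
    ⟨x0, hinj0, hx0, by simp_rw [Real.rpow_natCast]⟩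
  have hlow : ∀ E ∈ S, (N:ℝ)^2 * (W⁻¹ * (- Real.log b - d)) - N * (b^d)⁻¹ ≤ E := by
    rintro E ⟨x, hinj, hx, rfl⟩
    simp_rw [Real.rpow_natCast]
    have hlo := mul_le_mul_of_nonneg_left (lower_integral d hd b hb hb1) (inv_pos.mpr hW0).le
    -- a globally continuous version of the kernel
    have hcont2 : Continuous (fun u : ℝ => ((max (2 + b^2 - 2 * u) (b^2))^((d:ℝ)/2))⁻¹) := by
      have hp : ∀ u : ℝ, 0 < max (2 + b^2 - 2 * u) (b^2) := fun u => lt_max_of_lt_right (by positivity)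
      apply Continuous.inv₀
      · apply Continuous.rpow_const (by fun_prop)
        intro u; left; exact (hp u).ne'
      · intro u
        exact (Real.rpow_pos_of_pos (hp u) _).ne'
    have hJ2 : ∀ x : EuclideanSpace ℝ (Fin (d+1)), ‖x‖ = 1 →
      ∫ y, ((2 + b^2 - 2 * inner ℝ x y)^((d:ℝ)/2))⁻¹ ∂σ = W⁻¹ * 
        ∫ θ in 0..Real.pi, ((2 + b^2 - 2 * Real.cos θ)^((d:ℝ)/2))⁻¹ * Real.sin θ ^ (d-1) := by
      intro x hx
      have h := hform x hx _ hcont2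
      have e1 : ∫ y, ((2 + b^2 - 2 * inner ℝ x y)^((d:ℝ)/2))⁻¹ ∂σ =
          ∫ y, ((max (2 + b^2 - 2 * inner ℝ x y) (b^2))^((d:ℝ)/2))⁻¹ ∂σ := by
        apply integral_congr_ae
        filter_upwards [hae] with y hy
        rw [max_eq_left]
        have := (abs_le.mp (abs_inner_le_one' hx hy)).2
        linarith
      rw [e1, h]
      have e2 : ∀ θ : ℝ, max (2 + b^2 - 2 * Real.cos θ) (b^2) = 2 + b^2 - 2 * Real.cos θ := by
        intro θ
        apply max_eq_left
        linarith [Real.cos_le_one θ]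
      simp_rw [e2]
    have h := lower_energy d σ hae hd _ (fun k x hx => hform x hx (fun u => u^k) (by fun_prop)) b hb _ hJ2 N x hinj hx
    refine le_trans ?_ h
    gcongr
  constructor
  · rw [hm]
    refine (csInf_le ⟨_, hlow⟩ hmem).trans (hE0.trans ?_)
    gcongr
  · rw [hm]
    exact le_csInf ⟨_, hmem⟩ hlow

/-- in the boundary case `s = d`, the minimal Riesz `d`-energy of `S^d`
satisfies `lim_{N→∞} ℰ_d(S^d; N)/(N² log N) = H_d(B^d)/H_d(S^d)
 = (1/d) Γ((d+1)/2)/(√π Γ(d/2))`. -/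
theorem minimal_riesz_energy_boundary_case (d : ℕ) (hd : 1 ≤ d) :
    Tendsto (fun N : ℕ => minRieszEnergy d (d : ℝ) N / ((N : ℝ) ^ 2 * Real.log N)) atTop
      (nhds ((1 / (d : ℝ)) * Real.Gamma (((d : ℝ) + 1) / 2) /
        (Real.sqrt Real.pi * Real.Gamma ((d : ℝ) / 2)))) := by
  obtain ⟨W, hW0, hW, hB⟩ := minRiesz_bounds d hd
  have hd0 : (0:ℝ) < d := by exact_mod_cast hd
  have hconst : (1 / (d : ℝ)) * Real.Gamma (((d : ℝ) + 1) / 2) /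
        (Real.sqrt Real.pi * Real.Gamma ((d : ℝ) / 2)) = W⁻¹ * (1 / d) := by
    rw [hW, wallis_gamma]
    have e : ((d - 1 : ℕ) : ℝ) = d - 1 := by push_cast [hd]; ring
    rw [e]
    have e1 : ((d:ℝ) - 1 + 1) / 2 = d / 2 := by ring
    have e2 : ((d:ℝ) - 1) / 2 + 1 = (d + 1) / 2 := by ring
    rw [e1, e2, inv_div]
    ring
  rw [hconst]
  have hroot : ∀ x : ℝ, 0 < x → ((x ^ (-(1 / (d:ℝ))))^d)⁻¹ = x := by
    intro x hx
    rw [← Real.rpow_natCast, ← Real.rpow_mul hx.le]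
    have : -(1 / (d:ℝ)) * d = -1 := by field_simp
    rw [this, Real.rpow_neg_one, inv_inv]
  have hLt : Tendsto (fun N : ℕ => Real.log N) atTop atTop :=
    Real.tendsto_log_atTop.comp tendsto_natCast_atTop_atTop
  have hinv : Tendsto (fun N : ℕ => (Real.log N)⁻¹) atTop (nhds 0) :=
    tendsto_inv_atTop_zero.comp hLt
  have hll0 : Tendsto (fun x : ℝ => Real.log x / x) atTop (nhds 0) :=
    Real.isLittleO_log_id_atTop.tendsto_div_nhds_zero
  have hll : Tendsto (fun N : ℕ => Real.log (Real.log N) / Real.log N) atTop (nhds 0) :=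
    hll0.comp hLt
  have hcond : Tendsto (fun N : ℕ => (W⁻¹ * ((1 + Real.log 4) * (Real.log N)⁻¹ +
      (1 + 2 * (Real.log (Real.log N) / Real.log N)) / d))) atTop (nhds (W⁻¹ * (1 / d))) := by
    have := (((hinv.const_mul (1 + Real.log 4)).add
      (((hll.const_mul 2).const_add 1).div_const (d:ℝ)))).const_mul W⁻¹
    simpa using this
  have hlower : Tendsto (fun N : ℕ => W⁻¹ * (1 / d - d * (Real.log N)⁻¹) - (Real.log N)⁻¹)
      atTop (nhds (W⁻¹ * (1 / d))) := by
    have := (((hinv.const_mul (d:ℝ)).const_sub (1 / (d:ℝ))).const_mul W⁻¹).sub hinv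
    simpa using this
  have hmain : ∀ᶠ N : ℕ in atTop,
      W⁻¹ * (1 / d - d * (Real.log N)⁻¹) - (Real.log N)⁻¹ ≤
        minRieszEnergy d (d : ℝ) N / ((N : ℝ) ^ 2 * Real.log N) ∧
      minRieszEnergy d (d : ℝ) N / ((N : ℝ) ^ 2 * Real.log N) ≤
        W⁻¹ * ((1 + Real.log 4) * (Real.log N)⁻¹ +
          (1 + 2 * (Real.log (Real.log N) / Real.log N)) / d) := by
    have hlt : ∀ᶠ N : ℕ in atTop, W⁻¹ * ((1 + Real.log 4) * (Real.log N)⁻¹ +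
      (1 + 2 * (Real.log (Real.log N) / Real.log N)) / d) < W⁻¹ * (1 / d) + 1 :=
      hcond.eventually_lt_const (by linarith)
    filter_upwards [hlt, hLt.eventually_ge_atTop (W⁻¹ * (1 / d) + 1), eventually_ge_atTop 1]
      with N h1 h2 hN1
    set L := Real.log N with hL
    have hc : 0 < W⁻¹ * (1 / (d:ℝ)) := by positivity
    have hL1 : 1 ≤ L := by linarith
    have hL0 : 0 < L := by linarith
    have hNr : (1:ℝ) ≤ N := by exact_mod_cast hN1
    have hN0 : (0:ℝ) < N := by linarith
    have hM1 : 1 ≤ N * L^2 := by nlinarith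
    have hM0 : 0 < N * L^2 := by linarith
    have hexp : -(1 / (d:ℝ)) ≤ 0 := by
      have : 0 < 1 / (d:ℝ) := by positivity
      linarith
    have hlogδ : Real.log ((N * L^2) ^ (-(1 / (d:ℝ)))) = -((L + 2 * Real.log L) / d) := by
      rw [Real.log_rpow hM0, Real.log_mul hN0.ne' (by positivity), Real.log_pow, ← hL]
      push_cast
      ring
    have hlogb : Real.log ((N:ℝ) ^ (-(1 / (d:ℝ)))) = -(L / d) := by
      rw [Real.log_rpow hN0, ← hL]
      ring
    have hU : W⁻¹ * (1 + Real.log 4 - -((L + 2 * Real.log L) / d)) =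
      (W⁻¹ * ((1 + Real.log 4) * L⁻¹ + (1 + 2 * (Real.log L / L)) / d)) * L := by
      field_simp
      ring
    obtain ⟨hu, hl⟩ := hB N ((N * L^2) ^ (-(1 / (d:ℝ)))) ((N:ℝ) ^ (-(1 / (d:ℝ))))
      (Real.rpow_pos_of_pos hM0 _) (Real.rpow_le_one_of_one_le_of_nonpos hM1 hexp)
      (Real.rpow_pos_of_pos hN0 _) (Real.rpow_le_one_of_one_le_of_nonpos hNr hexp)
      (by
        rw [hroot _ hM0, hlogδ, hU]
        apply mul_lt_mul_of_pos_left _ hN0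
        rw [pow_two]
        apply mul_lt_mul_of_pos_right _ hL0
        linarith)
    rw [hlogδ, hU] at hu
    rw [hlogb, hroot _ hN0] at hl
    have hP : 0 < (N:ℝ)^2 * L := by positivity
    constructor
    · rw [le_div_iff₀ hP]
      refine le_trans (le_of_eq ?_) hl
      field_simp
    · rw [div_le_iff₀ hP]
      refine hu.trans (le_of_eq ?_)
      ring
  exact tendsto_of_tendsto_of_tendsto_of_le_of_le' hlower hcond
    (hmain.mono fun _ h => h.1) (hmain.mono fun _ h => h.2)
end
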